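/- arXiv:1701.00625 — 2 statements merged into one kernel-verified Lean document; each statement's English description precedes it below -/
import Mathlib

section
/- Existence of a continuous version of the limit process: if the integrals ∫_S σ²(v)/(1−h(v))² μ(dv) and ∫_S σ²(v)/((1−h(v))(2h(v)−1)) μ(dv) are finite, then the zero-mean Gaussian L²(μ,ℂ)-valued process G = {G(·,t) : t ∈ [0,1]} with cross-covariances E(G(r,t)·conj(G(s,u))) = V((r,t),(s,u)) satisfies E‖G(·,t) − G(·,u)‖⁴ ≤ K · |t−u|² for a finite constant K (indeed E‖G(·,t) − G(·,u)‖² = ∫_S σ²(v)(c(v)+conj(c(v)))|t−u|^{3−2h(v)} / (2(1−h(v))(3−2h(v))) μ(dv) ≤ (∫_S σ²(v)/(1−h(v))² μ(dv) + ∫_S σ²(v)/((1−h(v))(2h(v)−1)) μ(dv)) · |t−u| for t,u ∈ [0,1]), and hence G has a continuous version as an L²(μ,ℂ)-valued process on [0,1]. -/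
open MeasureTheory

open Filter Topology in
/-- Uniform convergence of dyadic step approximations to a continuous function. -/
lemma exists_continuousOn_of_dyadic_dist_le {E : Type*} [PseudoMetricSpace E] [CompleteSpace E]
    (x : ℝ → E) (b : ℕ → ℝ) (hb : Summable b)
    (h : ∀ n k : ℕ, k < 2 ^ n → dist (x (k / 2 ^ n)) (x ((k + 1 : ℕ) / 2 ^ n)) ≤ b n) :
    ∃ f : ℝ → E, ContinuousOn f (Set.Icc 0 1) ∧
      ∀ t ∈ Set.Icc (0 : ℝ) 1,
        Tendsto (fun n : ℕ => x (⌊t * 2 ^ n⌋₊ / 2 ^ n)) atTop (𝓝 (f t)) := by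
  have hb0 : ∀ n, 0 ≤ b n := fun n => dist_nonneg.trans (h n 0 (by positivity))
  have hb' : Summable fun n => b (n + 1) := (summable_nat_add_iff 1).2 hb
  have floor_le : ∀ t ∈ Set.Icc (0 : ℝ) 1, ∀ n : ℕ, ⌊t * 2 ^ n⌋₊ ≤ 2 ^ n := by
    intro t ht n
    apply Nat.floor_le_of_le
    push_cast
    nlinarith [ht.2, pow_pos (two_pos : (0 : ℝ) < 2) n]
  have hstep : ∀ t ∈ Set.Icc (0 : ℝ) 1, ∀ n : ℕ,
      dist (x (⌊t * 2 ^ n⌋₊ / 2 ^ n)) (x (⌊t * 2 ^ (n + 1)⌋₊ / 2 ^ (n + 1))) ≤ b (n + 1) := by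
    intro t ht n
    have h2 : (⌊t * 2 ^ n⌋₊ : ℝ) / 2 ^ n = ((2 * ⌊t * 2 ^ n⌋₊ : ℕ) : ℝ) / 2 ^ (n + 1) := by
      push_cast; rw [pow_succ]; field_simp
    have ht0 : 0 ≤ t * 2 ^ n := mul_nonneg ht.1 (by positivity)
    have ht0' : 0 ≤ t * 2 ^ (n + 1) := mul_nonneg ht.1 (by positivity)
    have e : t * 2 ^ (n + 1) = 2 * (t * 2 ^ n) := by ring
    have l1 : 2 * ⌊t * 2 ^ n⌋₊ ≤ ⌊t * 2 ^ (n + 1)⌋₊ := by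
      apply Nat.le_floor
      push_cast
      linarith [Nat.floor_le ht0]
    have l2 : ⌊t * 2 ^ (n + 1)⌋₊ < 2 * ⌊t * 2 ^ n⌋₊ + 2 := by
      rw [Nat.floor_lt ht0']
      push_cast
      linarith [Nat.lt_floor_add_one (t * 2 ^ n)]
    rw [h2]
    rcases Nat.lt_or_ge (2 * ⌊t * 2 ^ n⌋₊) ⌊t * 2 ^ (n + 1)⌋₊ with hlt | hge
    · have : ⌊t * 2 ^ (n + 1)⌋₊ = 2 * ⌊t * 2 ^ n⌋₊ + 1 := by omega
      rw [this]
      apply h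
      have := floor_le t ht (n + 1)
      omega
    · rw [le_antisymm hge l1, dist_self]
      exact hb0 _
  have hlim : ∀ t ∈ Set.Icc (0 : ℝ) 1, ∃ y, Tendsto (fun n : ℕ => x (⌊t * 2 ^ n⌋₊ / 2 ^ n))
      atTop (𝓝 y) := fun t ht => cauchySeq_tendsto_of_complete
    (cauchySeq_of_dist_le_of_summable _ (hstep t ht) hb')
  have : Nonempty E := ⟨x 0⟩
  choose! f hf using hlim
  refine ⟨f, ?_, hf⟩
  rw [Metric.continuousOn_iff]
  intro t ht ε hε
  have htail : Tendsto (fun n => ∑' m, b (n + m + 1)) atTop (𝓝 0) := by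
    have := tendsto_sum_nat_add fun n => b (n + 1)
    refine this.congr fun n => ?_
    congr 1
    ext m
    congr 1
    ring
  obtain ⟨n, hn1, hn2⟩ := ((htail.eventually (gt_mem_nhds (show (0 : ℝ) < ε / 3 by positivity))).and
    (hb.tendsto_atTop_zero.eventually (gt_mem_nhds (show (0 : ℝ) < ε / 3 by positivity)))).exists
  have happrox : ∀ t ∈ Set.Icc (0 : ℝ) 1, dist (x (⌊t * 2 ^ n⌋₊ / 2 ^ n)) (f t) < ε / 3 :=
    fun t ht => (dist_le_tsum_of_dist_le_of_tendsto _ (hstep t ht) hb' (hf t ht) n).trans_lt hn1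
  have hjump : ∀ t ∈ Set.Icc (0 : ℝ) 1, ∀ s ∈ Set.Icc (0 : ℝ) 1, t ≤ s → s - t < 1 / 2 ^ n →
      dist (x (⌊t * 2 ^ n⌋₊ / 2 ^ n)) (x (⌊s * 2 ^ n⌋₊ / 2 ^ n)) ≤ b n := by
    intro t ht s hs hts hst
    have l1 : ⌊t * 2 ^ n⌋₊ ≤ ⌊s * 2 ^ n⌋₊ := Nat.floor_mono (by gcongr)
    have l2 : ⌊s * 2 ^ n⌋₊ < ⌊t * 2 ^ n⌋₊ + 2 := by
      rw [Nat.floor_lt (mul_nonneg hs.1 (by positivity))]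
      push_cast
      rw [lt_div_iff₀ (by positivity)] at hst
      linarith [Nat.lt_floor_add_one (t * 2 ^ n)]
    rcases Nat.lt_or_ge ⌊t * 2 ^ n⌋₊ ⌊s * 2 ^ n⌋₊ with hlt | hge
    · have : ⌊s * 2 ^ n⌋₊ = ⌊t * 2 ^ n⌋₊ + 1 := by omega
      rw [this]
      apply h
      have := floor_le s hs n
      omega
    · rw [le_antisymm hge l1, dist_self]
      exact hb0 _
  refine ⟨1 / 2 ^ n, by positivity, fun s hs hst => ?_⟩
  have hj : dist (x (⌊s * 2 ^ n⌋₊ / 2 ^ n)) (x (⌊t * 2 ^ n⌋₊ / 2 ^ n)) ≤ b n := by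
    rw [Real.dist_eq, abs_lt] at hst
    rcases le_total t s with hle | hle
    · rw [dist_comm]
      exact hjump t ht s hs hle hst.2
    · exact hjump s hs t ht hle (by linarith)
  have h1 := happrox t ht
  have h2 := happrox s hs
  have h3 := dist_triangle4 (f s) (x (⌊s * 2 ^ n⌋₊ / 2 ^ n)) (x (⌊t * 2 ^ n⌋₊ / 2 ^ n)) (f t)
  rw [dist_comm] at h2
  linarith

open Filter Topology in
/-- A case of the Kolmogorov–Chentsov theorem: a process on `[0,1]` with values in a complete
metric space whose increments satisfy `E d(X s, X t)⁴ ≤ K |s - t|²` has a continuous version. -/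
lemma exists_continuous_version_of_lintegral_edist_pow_four_le
    {Ω E : Type*} [MeasurableSpace Ω] {P : Measure Ω} [MetricSpace E] [CompleteSpace E] [Nonempty E]
    (X : ℝ → Ω → E) (K : NNReal)
    (hmeas : ∀ s ∈ Set.Icc (0 : ℝ) 1, ∀ t ∈ Set.Icc (0 : ℝ) 1,
      AEMeasurable (fun ω => edist (X s ω) (X t ω)) P)
    (hX : ∀ s ∈ Set.Icc (0 : ℝ) 1, ∀ t ∈ Set.Icc (0 : ℝ) 1,
      ∫⁻ ω, edist (X s ω) (X t ω) ^ 4 ∂P ≤ K * ENNReal.ofReal (|s - t| ^ 2)) :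
    ∃ Y : Ω → ℝ → E, (∀ ω, ContinuousOn (Y ω) (Set.Icc 0 1)) ∧
      ∀ t ∈ Set.Icc (0 : ℝ) 1, ∀ᵐ ω ∂P, Y ω t = X t ω := by
  classical
  have hmem : ∀ n k : ℕ, k ≤ 2 ^ n → (k / 2 ^ n : ℝ) ∈ Set.Icc (0 : ℝ) 1 := by
    intro n k hk
    refine ⟨by positivity, ?_⟩
    rw [div_le_one (by positivity)]
    exact_mod_cast hk
  let q : NNReal := 125 / 64
  let a : ℕ → Ω → ENNReal := fun n ω => (q : ENNReal) ^ n * ∑ k ∈ Finset.range (2 ^ n),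
    edist (X (k / 2 ^ n) ω) (X ((k + 1 : ℕ) / 2 ^ n) ω) ^ 4
  have hsum_meas : ∀ n, ∀ k ∈ Finset.range (2 ^ n), AEMeasurable (fun ω =>
      edist (X (k / 2 ^ n) ω) (X ((k + 1 : ℕ) / 2 ^ n) ω) ^ 4) P := fun n k hk => by
    rw [Finset.mem_range] at hk
    exact (hmeas _ (hmem n k hk.le) _ (hmem n (k + 1) hk)).pow_const 4
  have ha_meas : ∀ n, AEMeasurable (a n) P := fun n =>
    (Finset.aemeasurable_fun_sum _ (hsum_meas n)).const_mul _
  have ha_int : ∀ n, ∫⁻ ω, a n ω ∂P ≤ K * ((125 / 128 : NNReal) : ENNReal) ^ n := by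
    intro n
    rw [lintegral_const_mul'' _ (Finset.aemeasurable_fun_sum _ (hsum_meas n)),
      lintegral_finsetSum' _ (hsum_meas n)]
    have hk : ∀ k ∈ Finset.range (2 ^ n),
        ∫⁻ ω, edist (X (k / 2 ^ n) ω) (X ((k + 1 : ℕ) / 2 ^ n) ω) ^ 4 ∂P
          ≤ K * ((1 / 4 : NNReal) : ENNReal) ^ n := by
      intro k hk
      rw [Finset.mem_range] at hk
      refine (hX _ (hmem n k hk.le) _ (hmem n (k + 1) hk)).trans (le_of_eq ?_)
      congr 1
      rw [← ENNReal.coe_pow, ← ENNReal.ofReal_coe_nnreal]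
      congr 1
      push_cast
      have : (k / 2 ^ n - (k + 1) / 2 ^ n : ℝ) = -(1 / 2) ^ n := by
        rw [one_div_pow]; ring
      rw [this, abs_neg, sq_abs, ← pow_mul, mul_comm, pow_mul]
      norm_num
    refine (mul_le_mul_right (Finset.sum_le_card_nsmul _ _ _ hk) _).trans (le_of_eq ?_)
    rw [Finset.card_range, nsmul_eq_mul]
    norm_cast
    have : (125 / 128 : NNReal) = q * (2 * (1 / 4)) := by
      ext; simp only [q]; push_cast; norm_num
    rw [this, mul_pow, mul_pow]
    push_cast
    ring
  have hae : ∀ᵐ ω ∂P, ∑' n, a n ω < ⊤ := by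
    apply ae_lt_top' (AEMeasurable.tsum ha_meas)
    rw [lintegral_tsum ha_meas]
    refine ne_top_of_le_ne_top ?_ (ENNReal.tsum_le_tsum ha_int)
    rw [ENNReal.tsum_mul_left]
    refine ENNReal.mul_ne_top ENNReal.coe_ne_top ?_
    simp_rw [← ENNReal.coe_pow]
    rw [ENNReal.tsum_coe_ne_top_iff_summable]
    apply NNReal.summable_geometric
    rw [← NNReal.coe_lt_coe]
    push_cast
    norm_num
  have hgood : ∀ ω, ∑' n, a n ω < ⊤ → ∃ f : ℝ → E, ContinuousOn f (Set.Icc 0 1) ∧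
      ∀ t ∈ Set.Icc (0 : ℝ) 1,
        Tendsto (fun n : ℕ => X (⌊t * 2 ^ n⌋₊ / 2 ^ n) ω) atTop (𝓝 (f t)) := by
    intro ω hω
    have hfin : ∀ n, a n ω ≠ ⊤ := ENNReal.ne_top_of_tsum_ne_top hω.ne
    refine exists_continuousOn_of_dyadic_dist_le (fun t => X t ω)
      (fun n => (4 / 5 : ℝ) ^ n + (a n ω).toReal)
      ((summable_geometric_of_lt_one (by norm_num) (by norm_num)).add
        (ENNReal.summable_toReal hω.ne)) fun n k hk => ?_
    set D := dist (X (k / 2 ^ n) ω) (X ((k + 1 : ℕ) / 2 ^ n) ω) with hD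
    have hD0 : 0 ≤ D := dist_nonneg
    have hDa : (125 / 64 : ℝ) ^ n * D ^ 4 ≤ (a n ω).toReal := by
      rw [← ENNReal.ofReal_le_iff_le_toReal (hfin n), ENNReal.ofReal_mul (by positivity),
        ENNReal.ofReal_pow hD0, hD, ← edist_dist, ENNReal.ofReal_pow (by norm_num)]
      have : ENNReal.ofReal (125 / 64) = (q : ENNReal) := by
        rw [← ENNReal.ofReal_coe_nnreal]; congr 1
      rw [this]
      refine mul_le_mul_right ?_ _
      exact Finset.single_le_sum (f := fun k : ℕ =>
        edist (X (k / 2 ^ n) ω) (X ((k + 1 : ℕ) / 2 ^ n) ω) ^ 4) (fun _ _ => zero_le)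
        (Finset.mem_range.2 hk)
    rcases le_total D ((4 / 5 : ℝ) ^ n) with hle | hle
    · linarith [ENNReal.toReal_nonneg (a := a n ω)]
    · have : D ≤ (125 / 64 : ℝ) ^ n * D ^ 4 := by
        calc D = (125 / 64 : ℝ) ^ n * (((4 / 5 : ℝ) ^ n) ^ 3) * D := by
              rw [← pow_mul, mul_comm n 3, pow_mul, ← mul_pow]; norm_num
          _ ≤ (125 / 64 : ℝ) ^ n * D ^ 3 * D := by gcongr
          _ = _ := by ring
      have : (0 : ℝ) < (4 / 5) ^ n := by positivity
      linarith
  let Y : Ω → ℝ → E := fun ω => if hω : ∑' n, a n ω < ⊤ then (hgood ω hω).choose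
    else fun _ => Classical.arbitrary E
  refine ⟨Y, fun ω => ?_, fun t ht => ?_⟩
  · simp only [Y]
    split_ifs with hω
    · exact (hgood ω hω).choose_spec.1
    · exact continuousOn_const
  have hflm : ∀ n : ℕ, (⌊t * 2 ^ n⌋₊ / 2 ^ n : ℝ) ∈ Set.Icc (0 : ℝ) 1 := fun n => by
    apply hmem
    apply Nat.floor_le_of_le
    push_cast
    nlinarith [ht.2, pow_pos (two_pos : (0 : ℝ) < 2) n]
  have hconv : ∀ᵐ ω ∂P, ∑' n : ℕ, edist (X (⌊t * 2 ^ n⌋₊ / 2 ^ n) ω) (X t ω) ^ 4 < ⊤ := by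
    have hm : ∀ n : ℕ, AEMeasurable
        (fun ω => edist (X (⌊t * 2 ^ n⌋₊ / 2 ^ n) ω) (X t ω) ^ 4) P :=
      fun n => (hmeas _ (hflm n) _ ht).pow_const 4
    apply ae_lt_top' (AEMeasurable.tsum hm)
    rw [lintegral_tsum hm]
    have hb : ∀ n : ℕ, ∫⁻ ω, edist (X (⌊t * 2 ^ n⌋₊ / 2 ^ n) ω) (X t ω) ^ 4 ∂P
        ≤ K * (((1 / 4 : NNReal) ^ n : NNReal) : ENNReal) := by
      intro n
      refine (hX _ (hflm n) _ ht).trans ?_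
      gcongr
      rw [← ENNReal.ofReal_coe_nnreal]
      apply ENNReal.ofReal_le_ofReal
      have : |(⌊t * 2 ^ n⌋₊ / 2 ^ n : ℝ) - t| ≤ (1 / 2) ^ n := by
        have h0 : (0 : ℝ) < 2 ^ n := by positivity
        have h1 := Nat.floor_le (mul_nonneg ht.1 h0.le)
        have h2 := (Nat.lt_floor_add_one (t * 2 ^ n)).le
        rw [one_div_pow, abs_le]
        constructor
        · rw [neg_le_sub_iff_le_add, ← add_div, le_div_iff₀ h0]; linarith
        · rw [sub_le_iff_le_add, div_le_iff₀ h0, add_mul, one_div, inv_mul_cancel₀ h0.ne']; linarith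
      calc |(⌊t * 2 ^ n⌋₊ / 2 ^ n : ℝ) - t| ^ 2 ≤ ((1 / 2) ^ n) ^ 2 := by gcongr
        _ = _ := by rw [← pow_mul, mul_comm, pow_mul]; push_cast; norm_num
    refine ne_top_of_le_ne_top ?_ (ENNReal.tsum_le_tsum hb)
    rw [ENNReal.tsum_mul_left]
    refine ENNReal.mul_ne_top ENNReal.coe_ne_top ?_
    rw [ENNReal.tsum_coe_ne_top_iff_summable]
    apply NNReal.summable_geometric
    rw [← NNReal.coe_lt_coe]
    push_cast
    norm_num
  filter_upwards [hae, hconv] with ω hω hω'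
  have h1 : Tendsto (fun n : ℕ => X (⌊t * 2 ^ n⌋₊ / 2 ^ n) ω) atTop (𝓝 (Y ω t)) := by
    simp only [Y, dif_pos hω]
    exact (hgood ω hω).choose_spec.2 t ht
  refine tendsto_nhds_unique h1 ?_
  rw [tendsto_iff_edist_tendsto_0]
  have h2 := ENNReal.tendsto_atTop_zero_of_tsum_ne_top hω'.ne
  have h3 := h2.ennrpow_const (1 / 4 : ℝ)
  refine (h3.congr fun n => ?_).trans (by simp)
  rw [← ENNReal.rpow_natCast, ← ENNReal.rpow_mul]
  norm_num

open ProbabilityTheory in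
lemma exists_lintegral_enorm_pow_four_gaussianReal_le :
    ∃ M : NNReal, ∀ v : NNReal, ∫⁻ x, ‖x‖ₑ ^ 4 ∂gaussianReal 0 v
      ≤ M * (∫⁻ x, ‖x‖ₑ ^ 2 ∂gaussianReal 0 v) ^ 2 := by
  have h4 : ∫⁻ x, ‖x‖ₑ ^ 4 ∂gaussianReal 0 1 ≠ ⊤ := by
    have := (memLp_id_gaussianReal' (μ := 0) (v := 1) 4 (by simp)).eLpNorm_ne_top
    rw [eLpNorm_eq_lintegral_rpow_enorm_toReal (by simp) (by simp)] at this
    intro h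
    apply this
    simp [h]
  have h2 : ∫⁻ x, ‖x‖ₑ ^ 2 ∂gaussianReal 0 1 = 1 := by
    have h := (memLp_id_gaussianReal' (μ := 0) (v := 1) 2 (by simp)).ofReal_variance_eq
    rw [variance_id_gaussianReal, evariance] at h
    simpa using h.symm
  refine ⟨(∫⁻ x, ‖x‖ₑ ^ 4 ∂gaussianReal 0 1).toNNReal, fun v => ?_⟩
  have hv : gaussianReal 0 v = (gaussianReal 0 1).map (fun x => √(v : ℝ) * x) := by
    rw [gaussianReal_map_const_mul]
    congr 1
    · simp
    · ext; simp
  have hmap : ∀ n : ℕ, ∫⁻ x, ‖x‖ₑ ^ n ∂gaussianReal 0 v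
      = ‖√(v : ℝ)‖ₑ ^ n * ∫⁻ x, ‖x‖ₑ ^ n ∂gaussianReal 0 1 := by
    intro n
    rw [hv, lintegral_map (by fun_prop) (by fun_prop), ← lintegral_const_mul _ (by fun_prop)]
    simp_rw [enorm_mul, mul_pow]
  rw [hmap, hmap, h2, ENNReal.coe_toNNReal h4, mul_one, ← pow_mul, mul_comm]

lemma Complex.enorm_sq (z : ℂ) : ‖z‖ₑ ^ 2 = ‖z.re‖ₑ ^ 2 + ‖z.im‖ₑ ^ 2 := by
  simp_rw [← ofReal_norm, ← ENNReal.ofReal_pow (norm_nonneg _)]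
  rw [← ENNReal.ofReal_add (by positivity) (by positivity)]
  congr 1
  rw [Complex.sq_norm, Complex.normSq_apply]
  simp [sq]

open ProbabilityTheory in
/-- The fourth absolute moment of a complex random variable with centred Gaussian real and
imaginary parts is controlled by the square of the second one. -/
lemma exists_lintegral_enorm_pow_four_le_of_gaussian :
    ∃ M : NNReal, ∀ {Ω : Type*} [MeasurableSpace Ω] (P : Measure Ω) (Z : Ω → ℂ), Measurable Z →
      (∃ v, P.map (fun ω => (Z ω).re) = gaussianReal 0 v) →
      (∃ v, P.map (fun ω => (Z ω).im) = gaussianReal 0 v) →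
      ∫⁻ ω, ‖Z ω‖ₑ ^ 4 ∂P ≤ M * (∫⁻ ω, ‖Z ω‖ₑ ^ 2 ∂P) ^ 2 := by
  obtain ⟨M, hM⟩ := exists_lintegral_enorm_pow_four_gaussianReal_le
  refine ⟨2 * M, fun P Z hZ ⟨v, hv⟩ ⟨w, hw⟩ => ?_⟩
  have hre : Measurable fun ω => (Z ω).re := by fun_prop
  have him : Measurable fun ω => (Z ω).im := by fun_prop
  have h1 := hM v
  have h2 := hM w
  rw [← hv, lintegral_map (by fun_prop) hre, lintegral_map (by fun_prop) hre] at h1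
  rw [← hw, lintegral_map (by fun_prop) him, lintegral_map (by fun_prop) him] at h2
  have hsq : ∫⁻ ω, ‖Z ω‖ₑ ^ 2 ∂P = ∫⁻ ω, ‖(Z ω).re‖ₑ ^ 2 ∂P + ∫⁻ ω, ‖(Z ω).im‖ₑ ^ 2 ∂P := by
    simp_rw [Complex.enorm_sq]
    rw [lintegral_add_left (by fun_prop)]
  have h4 : ∀ ω, ‖Z ω‖ₑ ^ 4 ≤ 2 * (‖(Z ω).re‖ₑ ^ 4 + ‖(Z ω).im‖ₑ ^ 4) := by
    intro ω
    rw [show 4 = 2 * 2 from rfl, pow_mul, pow_mul, pow_mul, Complex.enorm_sq]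
    have := ENNReal.rpow_add_le_mul_rpow_add_rpow (‖(Z ω).re‖ₑ ^ 2) (‖(Z ω).im‖ₑ ^ 2)
      (p := 2) (by norm_num)
    norm_num at this
    exact this
  calc ∫⁻ ω, ‖Z ω‖ₑ ^ 4 ∂P ≤ ∫⁻ ω, 2 * (‖(Z ω).re‖ₑ ^ 4 + ‖(Z ω).im‖ₑ ^ 4) ∂P := lintegral_mono h4
    _ = 2 * (∫⁻ ω, ‖(Z ω).re‖ₑ ^ 4 ∂P + ∫⁻ ω, ‖(Z ω).im‖ₑ ^ 4 ∂P) := by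
      rw [lintegral_const_mul _ (by fun_prop), lintegral_add_left (by fun_prop)]
    _ ≤ 2 * (M * (∫⁻ ω, ‖(Z ω).re‖ₑ ^ 2 ∂P) ^ 2 + M * (∫⁻ ω, ‖(Z ω).im‖ₑ ^ 2 ∂P) ^ 2) := by
      gcongr
    _ ≤ _ := by
      rw [hsq]
      set x := ∫⁻ ω, ‖(Z ω).re‖ₑ ^ 2 ∂P
      set y := ∫⁻ ω, ‖(Z ω).im‖ₑ ^ 2 ∂P
      push_cast
      rw [← mul_add, ← mul_assoc]
      gcongr
      calc x ^ 2 + y ^ 2 ≤ x ^ 2 + y ^ 2 + 2 * x * y := le_self_add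
        _ = (x + y) ^ 2 := by ring

/-- Fourth moment bounds on the values of a random function pass to its `L²` norm. -/
lemma lintegral_sq_lintegral_enorm_sq_le {Ω S : Type*} [MeasurableSpace Ω] [MeasurableSpace S]
    {P : Measure Ω} {μ : Measure S} [SFinite P] [SFinite μ] (M : NNReal) (D : Ω → S → ℂ)
    (hD : Measurable fun q : Ω × S => D q.1 q.2)
    (h : ∀ v, ∫⁻ ω, ‖D ω v‖ₑ ^ 4 ∂P ≤ M * (∫⁻ ω, ‖D ω v‖ₑ ^ 2 ∂P) ^ 2) :
    ∫⁻ ω, (∫⁻ v, ‖D ω v‖ₑ ^ 2 ∂μ) ^ 2 ∂P ≤ M * (∫⁻ ω, ∫⁻ v, ‖D ω v‖ₑ ^ 2 ∂μ ∂P) ^ 2 := by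
  have hDω : ∀ v, Measurable fun ω => D ω v := fun v =>
    hD.comp (measurable_id.prodMk measurable_const)
  have hDv : ∀ ω, Measurable fun v => D ω v := fun ω =>
    hD.comp (measurable_const.prodMk measurable_id)
  have hroot : ∀ v, (∫⁻ ω, (‖D ω v‖ₑ ^ 2) ^ (2 : ℝ) ∂P) ^ (1 / 2 : ℝ)
      ≤ (M : ENNReal) ^ (1 / 2 : ℝ) * ∫⁻ ω, ‖D ω v‖ₑ ^ 2 ∂P := by
    intro v
    have h0 : ∀ ω, (‖D ω v‖ₑ ^ 2) ^ (2 : ℝ) = ‖D ω v‖ₑ ^ 4 := fun ω => by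
      rw [ENNReal.rpow_two, ← pow_mul]
    simp_rw [h0]
    refine (ENNReal.rpow_le_rpow (h v) (by norm_num)).trans (le_of_eq ?_)
    rw [ENNReal.mul_rpow_of_nonneg _ _ (by norm_num), ← ENNReal.rpow_two, ← ENNReal.rpow_mul]
    norm_num
  have hCS : ∀ v w, ∫⁻ ω, ‖D ω v‖ₑ ^ 2 * ‖D ω w‖ₑ ^ 2 ∂P
      ≤ M * ((∫⁻ ω, ‖D ω v‖ₑ ^ 2 ∂P) * ∫⁻ ω, ‖D ω w‖ₑ ^ 2 ∂P) := by
    intro v w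
    refine (ENNReal.lintegral_mul_le_Lp_mul_Lq P Real.HolderConjugate.two_two
      (f := fun ω => ‖D ω v‖ₑ ^ 2) (g := fun ω => ‖D ω w‖ₑ ^ 2)
      ((hDω v).enorm.pow_const 2).aemeasurable ((hDω w).enorm.pow_const 2).aemeasurable).trans ?_
    refine (mul_le_mul' (hroot v) (hroot w)).trans (le_of_eq ?_)
    rw [mul_mul_mul_comm, ← ENNReal.rpow_add_of_nonneg _ _ (by norm_num) (by norm_num)]
    norm_num
  have hm : Measurable fun q : Ω × S × S => ‖D q.1 q.2.1‖ₑ ^ 2 * ‖D q.1 q.2.2‖ₑ ^ 2 := by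
    have h1 : Measurable fun q : Ω × S × S => D q.1 q.2.1 :=
      hD.comp (g := D.uncurry) (f := fun q : Ω × S × S => (q.1, q.2.1)) (by fun_prop)
    have h2 : Measurable fun q : Ω × S × S => D q.1 q.2.2 :=
      hD.comp (g := D.uncurry) (f := fun q : Ω × S × S => (q.1, q.2.2)) (by fun_prop)
    fun_prop
  have hmean : Measurable fun v => ∫⁻ ω, ‖D ω v‖ₑ ^ 2 ∂P :=
    (hD.enorm.pow_const 2).lintegral_prod_left'
  calc ∫⁻ ω, (∫⁻ v, ‖D ω v‖ₑ ^ 2 ∂μ) ^ 2 ∂P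
      = ∫⁻ ω, ∫⁻ z : S × S, ‖D ω z.1‖ₑ ^ 2 * ‖D ω z.2‖ₑ ^ 2 ∂(μ.prod μ) ∂P := by
        refine lintegral_congr fun ω => ?_
        rw [sq]
        exact (lintegral_prod_mul ((hDv ω).enorm.pow_const 2).aemeasurable
          ((hDv ω).enorm.pow_const 2).aemeasurable).symm
    _ = ∫⁻ z : S × S, ∫⁻ ω, ‖D ω z.1‖ₑ ^ 2 * ‖D ω z.2‖ₑ ^ 2 ∂P ∂(μ.prod μ) :=
        lintegral_lintegral_swap hm.aemeasurable
    _ ≤ ∫⁻ z : S × S, M * ((∫⁻ ω, ‖D ω z.1‖ₑ ^ 2 ∂P) * ∫⁻ ω, ‖D ω z.2‖ₑ ^ 2 ∂P) ∂(μ.prod μ) :=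
        lintegral_mono fun z => hCS z.1 z.2
    _ = M * (∫⁻ v, ∫⁻ ω, ‖D ω v‖ₑ ^ 2 ∂P ∂μ) ^ 2 := by
        rw [lintegral_const_mul _ (by fun_prop),
          lintegral_prod_mul hmean.aemeasurable hmean.aemeasurable, sq]
    _ = _ := by
        rw [lintegral_lintegral_swap (f := fun ω v => ‖D ω v‖ₑ ^ 2)
          (hD.enorm.pow_const 2).aemeasurable]

/-- A bound for the Beta-type integral `∫₀^∞ x^{-a} (x+1)^{-b} dx` with `Re a = Re b = h`. -/
lemma norm_integral_cpow_mul_cpow_le {a b : ℂ} {h : ℝ} (ha : a.re = h) (hb : b.re = h)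
    (h1 : 1 / 2 < h) (h2 : h < 1) :
    ‖∫ x in Set.Ioi (0 : ℝ), (x : ℂ) ^ (-a) * ((x : ℂ) + 1) ^ (-b)‖
      ≤ 1 / (1 - h) + 1 / (2 * h - 1) := by
  have hnorm : ∀ x ∈ Set.Ioi (0 : ℝ), ‖(x : ℂ) ^ (-a) * ((x : ℂ) + 1) ^ (-b)‖
      = x ^ (-h) * (x + 1) ^ (-h) := by
    intro x hx
    have hx : 0 < x := hx
    rw [norm_mul, Complex.norm_cpow_eq_rpow_re_of_pos hx,
      show (x : ℂ) + 1 = ((x + 1 : ℝ) : ℂ) by push_cast; rfl,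
      Complex.norm_cpow_eq_rpow_re_of_pos (by linarith)]
    simp [ha, hb]
  have i1 : IntegrableOn (fun x : ℝ => x ^ (-h)) (Set.Ioc 0 1) :=
    (intervalIntegrable_iff_integrableOn_Ioc_of_le zero_le_one).1
      (intervalIntegral.intervalIntegrable_rpow' (by linarith))
  have i2 : IntegrableOn (fun x : ℝ => x ^ (-2 * h)) (Set.Ioi 1) :=
    integrableOn_Ioi_rpow_of_lt (by linarith) one_pos
  have l1 : ∀ x ∈ Set.Ioc (0 : ℝ) 1, x ^ (-h) * (x + 1) ^ (-h) ≤ x ^ (-h) := fun x hx =>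
    mul_le_of_le_one_right (Real.rpow_nonneg hx.1.le _)
      (Real.rpow_le_one_of_one_le_of_nonpos (by linarith [hx.1]) (by linarith))
  have l2 : ∀ x ∈ Set.Ioi (1 : ℝ), x ^ (-h) * (x + 1) ^ (-h) ≤ x ^ (-2 * h) := fun x hx => by
    have hx : 1 < x := hx
    have hx0 : 0 < x := by linarith
    rw [show -2 * h = -h + -h by ring, Real.rpow_add hx0]
    gcongr ?_ * ?_
    exact Real.rpow_le_rpow_of_nonpos hx0 (by linarith) (by linarith)
  have hpos : ∀ x : ℝ, 0 < x → 0 ≤ x ^ (-h) * (x + 1) ^ (-h) := fun x hx => by positivity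
  have hm : Measurable fun x : ℝ => x ^ (-h) * (x + 1) ^ (-h) := by fun_prop
  have j1 : IntegrableOn (fun x : ℝ => x ^ (-h) * (x + 1) ^ (-h)) (Set.Ioc 0 1) :=
    i1.mono' hm.aestronglyMeasurable ((ae_restrict_mem measurableSet_Ioc).mono fun x hx => by
      rw [Real.norm_of_nonneg (hpos x hx.1)]; exact l1 x hx)
  have j2 : IntegrableOn (fun x : ℝ => x ^ (-h) * (x + 1) ^ (-h)) (Set.Ioi 1) :=
    i2.mono' hm.aestronglyMeasurable ((ae_restrict_mem measurableSet_Ioi).mono fun x hx => by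
      rw [Real.norm_of_nonneg (hpos x (zero_lt_one.trans hx))]; exact l2 x hx)
  calc _ ≤ ∫ x in Set.Ioi (0 : ℝ), ‖(x : ℂ) ^ (-a) * ((x : ℂ) + 1) ^ (-b)‖ :=
        norm_integral_le_integral_norm _
    _ = ∫ x in Set.Ioi (0 : ℝ), x ^ (-h) * (x + 1) ^ (-h) :=
        setIntegral_congr_fun measurableSet_Ioi hnorm
    _ = (∫ x in Set.Ioc (0 : ℝ) 1, x ^ (-h) * (x + 1) ^ (-h))
          + ∫ x in Set.Ioi (1 : ℝ), x ^ (-h) * (x + 1) ^ (-h) := by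
        rw [← Set.Ioc_union_Ioi_eq_Ioi zero_le_one,
          setIntegral_union (Set.Ioc_disjoint_Ioi le_rfl) measurableSet_Ioi j1 j2]
    _ ≤ (∫ x in Set.Ioc (0 : ℝ) 1, x ^ (-h)) + ∫ x in Set.Ioi (1 : ℝ), x ^ (-2 * h) :=
        add_le_add (setIntegral_mono_on j1 i1 measurableSet_Ioc l1)
          (setIntegral_mono_on j2 i2 measurableSet_Ioi l2)
    _ = 1 / (1 - h) + 1 / (2 * h - 1) := by
        rw [← intervalIntegral.integral_of_le zero_le_one,
          integral_rpow (Or.inl (by linarith)), integral_Ioi_rpow_of_lt (by linarith) one_pos,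
          Real.one_rpow, Real.one_rpow, Real.zero_rpow (by linarith)]
        have e1 : -h + 1 = 1 - h := by ring
        have e2 : -2 * h + 1 = -(2 * h - 1) := by ring
        rw [e1, e2, sub_zero, neg_div_neg_eq]

/-- Under a Gaussian law of real and imaginary parts, a complex random variable is in `L²`. -/
lemma memLp_two_of_gaussian_re_im {Ω : Type*} [MeasurableSpace Ω] {P : Measure Ω} {Z : Ω → ℂ}
    (hZ : Measurable Z)
    (hre : ∃ v, P.map (fun ω => (Z ω).re) = ProbabilityTheory.gaussianReal 0 v)
    (him : ∃ v, P.map (fun ω => (Z ω).im) = ProbabilityTheory.gaussianReal 0 v) :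
    MemLp Z 2 P := by
  have key : ∀ X : Ω → ℝ, Measurable X →
      (∃ v, P.map X = ProbabilityTheory.gaussianReal 0 v) → MemLp X 2 P := by
    rintro X hX ⟨v, hv⟩
    have := ProbabilityTheory.memLp_id_gaussianReal' (μ := 0) (v := v) 2 (by simp)
    rw [← hv, memLp_map_measure_iff (by fun_prop) hX.aemeasurable] at this
    exact this
  exact memLp_re_im_iff.1 ⟨key _ (by fun_prop) hre, key _ (by fun_prop) him⟩

lemma integral_mul_conj_self {Ω : Type*} [MeasurableSpace Ω] {P : Measure Ω} (Z : Ω → ℂ) :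
    ∫ ω, Z ω * (starRingEnd ℂ) (Z ω) ∂P = ((∫ ω, ‖Z ω‖ ^ 2 ∂P : ℝ) : ℂ) := by
  rw [← integral_complex_ofReal]
  refine integral_congr_ae (.of_forall fun ω => ?_)
  simp only [Complex.mul_conj, Complex.normSq_eq_norm_sq]

lemma integral_norm_sub_sq_eq {Ω : Type*} [MeasurableSpace Ω] {P : Measure Ω} {a b : Ω → ℂ}
    (ha : MemLp a 2 P) (hb : MemLp b 2 P) :
    ((∫ ω, ‖a ω - b ω‖ ^ 2 ∂P : ℝ) : ℂ) =
      ∫ ω, a ω * (starRingEnd ℂ) (a ω) ∂P - ∫ ω, a ω * (starRingEnd ℂ) (b ω) ∂P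
        - ∫ ω, b ω * (starRingEnd ℂ) (a ω) ∂P + ∫ ω, b ω * (starRingEnd ℂ) (b ω) ∂P := by
  have hint : ∀ {x y : Ω → ℂ}, MemLp x 2 P → MemLp y 2 P →
      Integrable (fun ω => x ω * (starRingEnd ℂ) (y ω)) P :=
    fun hx hy => hx.integrable_mul hy.star
  rw [← integral_mul_conj_self, ← integral_sub (hint ha ha) (hint ha hb),
    ← integral_sub (by exact (hint ha ha).sub (hint ha hb)) (hint hb ha),
    ← integral_add (by exact ((hint ha ha).sub (hint ha hb)).sub (hint hb ha)) (hint hb hb)]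
  refine integral_congr_ae (.of_forall fun ω => ?_)
  simp only [map_sub]
  ring

lemma ofReal_integral_norm_sq {α : Type*} [MeasurableSpace α] {ν : Measure α} {f : α → ℂ}
    (hf : MemLp f 2 ν) : ENNReal.ofReal (∫ x, ‖f x‖ ^ 2 ∂ν) = ∫⁻ x, ‖f x‖ₑ ^ 2 ∂ν := by
  rw [ofReal_integral_eq_lintegral_ofReal hf.norm.integrable_sq (.of_forall fun _ => by positivity)]
  refine lintegral_congr fun x => ?_
  rw [ENNReal.ofReal_pow (norm_nonneg _), ofReal_norm]

lemma memLp_two_iff_lintegral_enorm_sq {α : Type*} [MeasurableSpace α] {ν : Measure α} {f : α → ℂ}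
    (hf : AEStronglyMeasurable f ν) : MemLp f 2 ν ↔ ∫⁻ x, ‖f x‖ₑ ^ 2 ∂ν < ⊤ := by
  rw [MemLp, and_iff_right hf,
    eLpNorm_lt_top_iff_lintegral_rpow_enorm_lt_top (by norm_num) (by norm_num)]
  simp

lemma edist_toLp_two_pow_four {α : Type*} [MeasurableSpace α] {ν : Measure α} {f g : α → ℂ}
    (hf : MemLp f 2 ν) (hg : MemLp g 2 ν) :
    edist (hf.toLp f) (hg.toLp g) ^ 4 = (∫⁻ x, ‖f x - g x‖ₑ ^ 2 ∂ν) ^ 2 := by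
  rw [Lp.edist_toLp_toLp, eLpNorm_eq_lintegral_rpow_enorm_toReal (by norm_num) (by norm_num),
    ← ENNReal.rpow_natCast, ← ENNReal.rpow_mul, ← ENNReal.rpow_natCast]
  norm_num

/-- Square moments of a random function, bounded pointwise by an integrable function. -/
lemma lintegral_lintegral_enorm_sq_le {Ω S : Type*} [MeasurableSpace Ω] [MeasurableSpace S]
    {P : Measure Ω} {μ : Measure S} [SFinite P] [SFinite μ] {D : Ω → S → ℂ}
    (hD : Measurable fun q : Ω × S => D q.1 q.2) (hD2 : ∀ v, MemLp (fun ω => D ω v) 2 P)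
    {g : S → ℝ} (hg : Integrable g μ) (hg0 : ∀ v, ∫ ω, ‖D ω v‖ ^ 2 ∂P ≤ g v) :
    ∫⁻ ω, ∫⁻ v, ‖D ω v‖ₑ ^ 2 ∂μ ∂P ≤ ENNReal.ofReal (∫ v, g v ∂μ) := by
  have h0 : ∀ v, 0 ≤ g v := fun v => (integral_nonneg fun ω => by positivity).trans (hg0 v)
  rw [lintegral_lintegral_swap (f := fun ω v => ‖D ω v‖ₑ ^ 2) (hD.enorm.pow_const 2).aemeasurable,
    ofReal_integral_eq_lintegral_ofReal hg (.of_forall h0)]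
  refine lintegral_mono fun v => ?_
  rw [← ofReal_integral_norm_sq (hD2 v)]
  exact ENNReal.ofReal_le_ofReal (hg0 v)

lemma integral_integral_norm_sq_swap {Ω S : Type*} [MeasurableSpace Ω] [MeasurableSpace S]
    {P : Measure Ω} {μ : Measure S} [SFinite P] [SFinite μ] {D : Ω → S → ℂ}
    (hD : Measurable fun q : Ω × S => D q.1 q.2)
    (hfin : ∫⁻ ω, ∫⁻ v, ‖D ω v‖ₑ ^ 2 ∂μ ∂P < ⊤) :
    ∫ ω, ∫ v, ‖D ω v‖ ^ 2 ∂μ ∂P = ∫ v, ∫ ω, ‖D ω v‖ ^ 2 ∂P ∂μ := by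
  refine integral_integral_swap ⟨(hD.norm.pow_const 2).aestronglyMeasurable, ?_⟩
  rw [HasFiniteIntegral, lintegral_prod (fun q : Ω × S => ‖Function.uncurry _ q‖ₑ)
    (hD.norm.pow_const 2).enorm.aemeasurable]
  simpa [Function.uncurry] using hfin

lemma integral_sq_integral_norm_sq_le {Ω S : Type*} [MeasurableSpace Ω] [MeasurableSpace S]
    {P : Measure Ω} {μ : Measure S} [SFinite P] [SFinite μ] {D : Ω → S → ℂ}
    (hD : Measurable fun q : Ω × S => D q.1 q.2) {R : ℝ} (hR : 0 ≤ R)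
    (h : ∫⁻ ω, (∫⁻ v, ‖D ω v‖ₑ ^ 2 ∂μ) ^ 2 ∂P ≤ ENNReal.ofReal R) :
    ∫ ω, (∫ v, ‖D ω v‖ ^ 2 ∂μ) ^ 2 ∂P ≤ R := by
  have hDv : ∀ ω, Measurable fun v => D ω v := fun ω =>
    hD.comp (measurable_const.prodMk measurable_id)
  have hin : ∀ ω, ∫ v, ‖D ω v‖ ^ 2 ∂μ = (∫⁻ v, ‖D ω v‖ₑ ^ 2 ∂μ).toReal := by
    intro ω
    rw [integral_eq_lintegral_of_nonneg_ae (.of_forall fun _ => by positivity)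
      ((hDv ω).norm.pow_const 2).aestronglyMeasurable]
    simp_rw [ENNReal.ofReal_pow (norm_nonneg _), ofReal_norm]
  have hL : Measurable fun ω => ∫⁻ v, ‖D ω v‖ₑ ^ 2 ∂μ :=
    (hD.enorm.pow_const 2).lintegral_prod_right'
  simp_rw [hin]
  rw [integral_eq_lintegral_of_nonneg_ae (.of_forall fun _ => by positivity)
    (hL.ennreal_toReal.pow_const 2).aestronglyMeasurable]
  refine ENNReal.toReal_le_of_le_ofReal hR (le_trans (lintegral_mono fun ω => ?_) h)
  rw [ENNReal.ofReal_pow ENNReal.toReal_nonneg]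
  gcongr
  exact ENNReal.ofReal_toReal_le

/-- **Existence of a continuous version of the limit process.**
If `∫ σ²(v)/(1−h(v))² dμ` and `∫ σ²(v)/((1−h(v))(2h(v)−1)) dμ` are finite, then the zero-mean
Gaussian `L²(μ,ℂ)`-valued process `G = {G(·,t) : t ∈ [0,1]}` with cross-covariances
`E(G(r,t) conj(G(s,u))) = V((r,t),(s,u))` satisfies
`E‖G(·,t) − G(·,u)‖² = ∫ σ²(v)(c(v)+conj(c(v)))|t−u|^{3−2h(v)} / (2(1−h(v))(3−2h(v))) dμ
  ≤ (I₁ + I₂)|t−u|` and `E‖G(·,t) − G(·,u)‖⁴ ≤ K|t−u|²` for a finite constant `K`;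
hence `G` has a continuous version as an `L²(μ,ℂ)`-valued process on `[0,1]`. -/
theorem continuous_version_of_limit_process
    {Ω : Type*} [MeasurableSpace Ω] (P : Measure Ω) [IsProbabilityMeasure P]
    {S : Type*} [MeasurableSpace S] (μ : Measure S) [SigmaFinite μ]
    (d : S → ℂ) (hd_meas : Measurable d) (hd_bdd : ∃ C : ℝ, ∀ x, ‖d x‖ ≤ C)
    (hd_range : ∀ x, 1 / 2 < (d x).re ∧ (d x).re < 1)
    (ε : ℤ → Ω → S → ℂ) (hε_meas : ∀ k, Measurable (ε k))
    (h_mean : ∀ x, ∫ ω, ε 0 ω x ∂P = 0)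
    (h_L2 : (∫⁻ ω, ∫⁻ x, (‖ε 0 ω x‖₊ : ENNReal) ^ 2 ∂μ ∂P) < ⊤)
    (h_mom : ∀ x, Integrable (fun ω => ‖ε 0 ω x‖ ^ 2) P)
    (σ : S → S → ℂ) (hσ : ∀ r x, σ r x = ∫ ω, ε 0 ω r * (starRingEnd ℂ) (ε 0 ω x) ∂P)
    (σ2 : S → ℝ) (hσ2 : ∀ x, σ2 x = ∫ ω, ‖ε 0 ω x‖ ^ 2 ∂P)
    (c : S → S → ℂ)
    (hc : ∀ r x, c r x = ∫ v in Set.Ioi (0 : ℝ),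
      (v : ℂ) ^ (-(d r)) * ((v : ℂ) + 1) ^ (-(starRingEnd ℂ) (d x)))
    (V : S × ℝ → S × ℝ → ℂ)
    (hV : ∀ r t s u, V (r, t) (s, u) =
      σ r s / ((3 - (d r + (starRingEnd ℂ) (d s))) * (2 - (d r + (starRingEnd ℂ) (d s)))) *
        ((starRingEnd ℂ) (c s r) * (t : ℂ) ^ ((3 : ℂ) - (d r + (starRingEnd ℂ) (d s)))
          + c r s * (u : ℂ) ^ ((3 : ℂ) - (d r + (starRingEnd ℂ) (d s)))
          - (if t - u < 0 then c r s else (starRingEnd ℂ) (c s r)) *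
              ((|t - u| : ℝ) : ℂ) ^ ((3 : ℂ) - (d r + (starRingEnd ℂ) (d s)))))
    (hI1 : Integrable (fun v => σ2 v / (1 - (d v).re) ^ 2) μ)
    (hI2 : Integrable (fun v => σ2 v / ((1 - (d v).re) * (2 * (d v).re - 1))) μ)
    -- a zero-mean Gaussian process `G` on `S × [0,1]` with cross-covariance function `V`,
    -- on some probability space `(Ω', P')`:
    {Ω' : Type*} [MeasurableSpace Ω'] (P' : Measure Ω') [IsProbabilityMeasure P']
    (G : Ω' → S → ℝ → ℂ)
    (hG_meas : ∀ t : ℝ, Measurable fun q : Ω' × S => G q.1 q.2 t)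
    (hG_gauss : ∀ (N : ℕ) (pts : Fin N → S × ℝ) (w : Fin N → ℂ),
      ∃ var : NNReal, P'.map (fun ω => (∑ i, w i * G ω (pts i).1 (pts i).2).re)
        = ProbabilityTheory.gaussianReal 0 var)
    (hG_cov : ∀ (r s : S) (t u : ℝ), t ∈ Set.Icc (0 : ℝ) 1 → u ∈ Set.Icc (0 : ℝ) 1 →
      ∫ ω, G ω r t * (starRingEnd ℂ) (G ω s u) ∂P' = V (r, t) (s, u)) :
    -- moment identity for the squared increments
    (∀ t u : ℝ, t ∈ Set.Icc (0 : ℝ) 1 → u ∈ Set.Icc (0 : ℝ) 1 →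
        (∫ ω, (∫ v, ‖G ω v t - G ω v u‖ ^ 2 ∂μ) ∂P')
            = ∫ v, σ2 v * (c v v + (starRingEnd ℂ) (c v v)).re *
                |t - u| ^ (3 - 2 * (d v).re) /
                  (2 * (1 - (d v).re) * (3 - 2 * (d v).re)) ∂μ
          ∧ (∫ ω, (∫ v, ‖G ω v t - G ω v u‖ ^ 2 ∂μ) ∂P')
              ≤ ((∫ v, σ2 v / (1 - (d v).re) ^ 2 ∂μ) +
                  ∫ v, σ2 v / ((1 - (d v).re) * (2 * (d v).re - 1)) ∂μ) * |t - u|)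
      -- fourth-moment bound
      ∧ (∃ K : ℝ, ∀ t u : ℝ, t ∈ Set.Icc (0 : ℝ) 1 → u ∈ Set.Icc (0 : ℝ) 1 →
          ∫ ω, (∫ v, ‖G ω v t - G ω v u‖ ^ 2 ∂μ) ^ 2 ∂P' ≤ K * |t - u| ^ 2)
      -- existence of a continuous `L²(μ,ℂ)`-valued version on `[0,1]`
      ∧ (∃ G' : Ω' → ℝ → Lp ℂ 2 μ,
          (∀ ω, ContinuousOn (G' ω) (Set.Icc (0 : ℝ) 1)) ∧
            ∀ t ∈ Set.Icc (0 : ℝ) 1, ∀ᵐ ω ∂P',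
              (G' ω t : S → ℂ) =ᵐ[μ] fun v => G ω v t) := by
  have hσ_self : ∀ v, σ v v = (σ2 v : ℂ) := fun v => by
    rw [hσ, hσ2, integral_mul_conj_self]
  have hσ2_nonneg : ∀ v, 0 ≤ σ2 v := fun v => by
    rw [hσ2]; exact integral_nonneg fun _ => by positivity
  set Φ : S → ℝ → ℝ := fun v τ => σ2 v * (c v v + (starRingEnd ℂ) (c v v)).re *
    τ ^ (3 - 2 * (d v).re) / (2 * (1 - (d v).re) * (3 - 2 * (d v).re)) with hΦ
  set g : S → ℝ := fun v => σ2 v / (1 - (d v).re) ^ 2 +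
    σ2 v / ((1 - (d v).re) * (2 * (d v).re - 1)) with hg
  have hg_int : Integrable g μ := hI1.add hI2
  have hg_nonneg : ∀ v, 0 ≤ g v := fun v => by
    have h1 : 0 < 1 - (d v).re := by linarith [(hd_range v).2]
    have h2 : 0 < 2 * (d v).re - 1 := by linarith [(hd_range v).1]
    have := hσ2_nonneg v
    simp only [hg]
    positivity
  have hΦ_le : ∀ v, ∀ τ ∈ Set.Icc (0 : ℝ) 1, Φ v τ ≤ g v * τ := by
    intro v τ hτ
    have h1 : 0 < 1 - (d v).re := by linarith [(hd_range v).2]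
    have h2 : 0 < 2 * (d v).re - 1 := by linarith [(hd_range v).1]
    have h3 : 1 < 3 - 2 * (d v).re := by linarith
    have hc_le : (c v v).re ≤ 1 / (1 - (d v).re) + 1 / (2 * (d v).re - 1) :=
      (Complex.re_le_norm _).trans (by
        rw [hc]
        exact norm_integral_cpow_mul_cpow_le rfl (Complex.conj_re _) (hd_range v).1 (hd_range v).2)
    have hτp : τ ^ (3 - 2 * (d v).re) ≤ τ := by
      rcases hτ.1.eq_or_lt with h0 | h0
      · rw [← h0, Real.zero_rpow (by linarith)]
      · simpa using Real.rpow_le_rpow_of_exponent_ge h0 hτ.2 h3.le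
    have hτ0 : 0 ≤ τ ^ (3 - 2 * (d v).re) := Real.rpow_nonneg hτ.1 _
    have hB : 0 ≤ 1 / (1 - (d v).re) + 1 / (2 * (d v).re - 1) := by positivity
    have hσv := hσ2_nonneg v
    calc Φ v τ = σ2 v * (c v v).re * τ ^ (3 - 2 * (d v).re) /
          ((1 - (d v).re) * (3 - 2 * (d v).re)) := by
          simp only [hΦ, Complex.add_re, Complex.conj_re]
          field_simp
          ring
      _ ≤ σ2 v * (1 / (1 - (d v).re) + 1 / (2 * (d v).re - 1)) * τ ^ (3 - 2 * (d v).re) /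
          ((1 - (d v).re) * (3 - 2 * (d v).re)) := by gcongr
      _ ≤ σ2 v * (1 / (1 - (d v).re) + 1 / (2 * (d v).re - 1)) * τ / ((1 - (d v).re) * 1) := by
          have := hτ.1
          gcongr
      _ = g v * τ := by simp only [hg]; field_simp
  have hV_self : ∀ v, ∀ t ∈ Set.Icc (0 : ℝ) 1, ∀ u ∈ Set.Icc (0 : ℝ) 1, V (v, t) (v, u) =
      (σ2 v : ℂ) / (((3 - 2 * (d v).re) * (2 - 2 * (d v).re) : ℝ) : ℂ) *
        ((starRingEnd ℂ) (c v v) * ((t ^ (3 - 2 * (d v).re) : ℝ) : ℂ)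
          + c v v * ((u ^ (3 - 2 * (d v).re) : ℝ) : ℂ)
          - (if t - u < 0 then c v v else (starRingEnd ℂ) (c v v)) *
            ((|t - u| ^ (3 - 2 * (d v).re) : ℝ) : ℂ)) := by
    intro v t ht u hu
    have hexp : d v + (starRingEnd ℂ) (d v) = ((2 * (d v).re : ℝ) : ℂ) := Complex.add_conj _
    rw [hV, hexp, hσ_self, Complex.ofReal_cpow ht.1, Complex.ofReal_cpow hu.1,
      Complex.ofReal_cpow (abs_nonneg _)]
    push_cast
    rfl
  have hΦ_cast : ∀ v τ, (Φ v τ : ℂ) =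
      (σ2 v : ℂ) / (((3 - 2 * (d v).re) * (2 - 2 * (d v).re) : ℝ) : ℂ) *
        ((c v v + (starRingEnd ℂ) (c v v)) * ((τ ^ (3 - 2 * (d v).re) : ℝ) : ℂ)) := by
    intro v τ
    rw [show c v v + (starRingEnd ℂ) (c v v) = ((2 * (c v v).re : ℝ) : ℂ) from Complex.add_conj _]
    simp only [hΦ, ← Complex.ofReal_mul, ← Complex.ofReal_div, Complex.add_re, Complex.conj_re]
    congr 1
    ring
  have hzero : ∀ v, (0 : ℝ) ^ (3 - 2 * (d v).re) = 0 := fun v =>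
    Real.zero_rpow (by linarith [(hd_range v).2])
  have hV_diag : ∀ v, ∀ t ∈ Set.Icc (0 : ℝ) 1, V (v, t) (v, t) = Φ v t := by
    intro v t ht
    rw [hV_self v t ht t ht, hΦ_cast, sub_self, abs_zero, hzero]
    push_cast
    ring
  have hV_incr : ∀ v, ∀ t ∈ Set.Icc (0 : ℝ) 1, ∀ u ∈ Set.Icc (0 : ℝ) 1,
      V (v, t) (v, t) - V (v, t) (v, u) - V (v, u) (v, t) + V (v, u) (v, u) = Φ v |t - u| := by
    intro v t ht u hu
    rw [hV_diag v t ht, hV_diag v u hu, hV_self v t ht u hu, hV_self v u hu t ht, hΦ_cast, hΦ_cast,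
      hΦ_cast, abs_sub_comm u t]
    rcases lt_trichotomy t u with h | rfl | h
    · rw [if_pos (by linarith), if_neg (by linarith)]
      ring
    · rw [sub_self, abs_zero, hzero]
      push_cast
      ring
    · rw [if_neg (by linarith), if_pos (by linarith)]
      ring
  have hG_meas' : ∀ v t, Measurable fun ω => G ω v t := fun v t =>
    (hG_meas t).comp (measurable_id.prodMk measurable_const)
  have hG_memLp : ∀ v t, MemLp (fun ω => G ω v t) 2 P' := by
    intro v t
    refine memLp_two_of_gaussian_re_im (hG_meas' v t) ?_ ?_
    · simpa using hG_gauss 1 (fun _ => (v, t)) (fun _ => 1)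
    · simpa using hG_gauss 1 (fun _ => (v, t)) (fun _ => -Complex.I)
  have hD_meas : ∀ t u, Measurable fun q : Ω' × S => G q.1 q.2 t - G q.1 q.2 u := fun t u =>
    (hG_meas t).sub (hG_meas u)
  have hD_memLp : ∀ v t u, MemLp (fun ω => G ω v t - G ω v u) 2 P' := fun v t u =>
    (hG_memLp v t).sub (hG_memLp v u)
  have hG_sq : ∀ v, ∀ t ∈ Set.Icc (0 : ℝ) 1, ∫ ω, ‖G ω v t‖ ^ 2 ∂P' = Φ v t := by
    intro v t ht
    rw [← Complex.ofReal_inj, ← integral_mul_conj_self, hG_cov v v t t ht ht, hV_diag v t ht]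
  have hD_sq : ∀ v, ∀ t ∈ Set.Icc (0 : ℝ) 1, ∀ u ∈ Set.Icc (0 : ℝ) 1,
      ∫ ω, ‖G ω v t - G ω v u‖ ^ 2 ∂P' = Φ v |t - u| := by
    intro v t ht u hu
    rw [← Complex.ofReal_inj, integral_norm_sub_sq_eq (hG_memLp v t) (hG_memLp v u),
      hG_cov v v t t ht ht, hG_cov v v t u ht hu, hG_cov v v u t hu ht, hG_cov v v u u hu hu,
      hV_incr v t ht u hu]
  have habs : ∀ t ∈ Set.Icc (0 : ℝ) 1, ∀ u ∈ Set.Icc (0 : ℝ) 1, |t - u| ∈ Set.Icc (0 : ℝ) 1 :=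
    fun t ht u hu => ⟨abs_nonneg _, abs_le.2 ⟨by linarith [ht.1, hu.2], by linarith [ht.2, hu.1]⟩⟩
  set I : ℝ := ∫ v, g v ∂μ with hI
  have hI0 : 0 ≤ I := integral_nonneg hg_nonneg
  have hD_lint : ∀ t ∈ Set.Icc (0 : ℝ) 1, ∀ u ∈ Set.Icc (0 : ℝ) 1,
      ∫⁻ ω, ∫⁻ v, ‖G ω v t - G ω v u‖ₑ ^ 2 ∂μ ∂P' ≤ ENNReal.ofReal (I * |t - u|) := by
    intro t ht u hu
    rw [hI, ← integral_mul_const]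
    exact lintegral_lintegral_enorm_sq_le (hD_meas t u) (fun v => hD_memLp v t u)
      (hg_int.mul_const _) fun v => (hD_sq v t ht u hu).le.trans (hΦ_le v _ (habs t ht u hu))
  have hG_lint : ∀ t ∈ Set.Icc (0 : ℝ) 1, ∫⁻ ω, ∫⁻ v, ‖G ω v t‖ₑ ^ 2 ∂μ ∂P' < ⊤ := by
    intro t ht
    exact (lintegral_lintegral_enorm_sq_le (hG_meas t) (fun v => hG_memLp v t)
      (hg_int.mul_const t) fun v => (hG_sq v t ht).le.trans (hΦ_le v _ ht)).trans_lt
        ENNReal.ofReal_lt_top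
  obtain ⟨M, hM⟩ := exists_lintegral_enorm_pow_four_le_of_gaussian
  have hD_four : ∀ t ∈ Set.Icc (0 : ℝ) 1, ∀ u ∈ Set.Icc (0 : ℝ) 1,
      ∫⁻ ω, (∫⁻ v, ‖G ω v t - G ω v u‖ₑ ^ 2 ∂μ) ^ 2 ∂P'
        ≤ M * ENNReal.ofReal (I * |t - u|) ^ 2 := by
    intro t ht u hu
    refine (lintegral_sq_lintegral_enorm_sq_le M (fun ω v => G ω v t - G ω v u) (hD_meas t u)
      fun v => hM P' _ ((hG_meas' v t).sub (hG_meas' v u)) ?_ ?_).trans ?_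
    · simpa [Fin.sum_univ_two, sub_eq_add_neg] using
        hG_gauss 2 ![(v, t), (v, u)] ![1, -1]
    · simpa [Fin.sum_univ_two, sub_eq_add_neg] using
        hG_gauss 2 ![(v, t), (v, u)] ![-Complex.I, Complex.I]
    · gcongr
      exact hD_lint t ht u hu
  refine ⟨fun t u ht hu => ?_, ⟨M * I ^ 2, fun t u ht hu => ?_⟩, ?_⟩
  · have heq : (∫ ω, (∫ v, ‖G ω v t - G ω v u‖ ^ 2 ∂μ) ∂P') = ∫ v, Φ v |t - u| ∂μ := by
      rw [integral_integral_norm_sq_swap (hD_meas t u)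
        ((hD_lint t ht u hu).trans_lt ENNReal.ofReal_lt_top)]
      simp_rw [hD_sq _ t ht u hu]
    refine ⟨heq, ?_⟩
    rw [heq, ← integral_add hI1 hI2, ← integral_mul_const]
    refine integral_mono_of_nonneg (.of_forall fun v => ?_) (hg_int.mul_const _)
      (.of_forall fun v => hΦ_le v _ (habs t ht u hu))
    simp only [← hD_sq v t ht u hu]
    exact integral_nonneg fun _ => by positivity
  · refine integral_sq_integral_norm_sq_le (hD_meas t u) (by positivity)
      ((hD_four t ht u hu).trans (le_of_eq ?_))
    rw [← ENNReal.ofReal_pow (by positivity), ← ENNReal.ofReal_coe_nnreal,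
      ← ENNReal.ofReal_mul (by positivity)]
    congr 1
    ring
  · classical
    set X : ℝ → Ω' → Lp ℂ 2 μ := fun t ω =>
      if h : MemLp (fun v => G ω v t) 2 μ then h.toLp _ else 0 with hX
    have hmem : ∀ t ∈ Set.Icc (0 : ℝ) 1, ∀ᵐ ω ∂P', MemLp (fun v => G ω v t) 2 μ := by
      intro t ht
      filter_upwards [ae_lt_top ((hG_meas t).enorm.pow_const 2).lintegral_prod_right'
        (hG_lint t ht).ne] with ω hω
      exact (memLp_two_iff_lintegral_enorm_sq
        ((hG_meas t).comp (measurable_const.prodMk measurable_id)).aestronglyMeasurable).2 hω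
    have hedist : ∀ s ∈ Set.Icc (0 : ℝ) 1, ∀ t ∈ Set.Icc (0 : ℝ) 1, ∀ᵐ ω ∂P',
        edist (X s ω) (X t ω) ^ 4 = (∫⁻ v, ‖G ω v s - G ω v t‖ₑ ^ 2 ∂μ) ^ 2 := by
      intro s hs t ht
      filter_upwards [hmem s hs, hmem t ht] with ω h1 h2
      simp only [hX, dif_pos h1, dif_pos h2, edist_toLp_two_pow_four]
    have hX_meas : ∀ s ∈ Set.Icc (0 : ℝ) 1, ∀ t ∈ Set.Icc (0 : ℝ) 1,
        AEMeasurable (fun ω => edist (X s ω) (X t ω)) P' := by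
      intro s hs t ht
      have hm : Measurable fun ω => ∫⁻ v, ‖G ω v s - G ω v t‖ₑ ^ 2 ∂μ :=
        ((hD_meas s t).enorm.pow_const 2).lintegral_prod_right'
      refine ((hm.pow_const 2).pow_const (1 / 4 : ℝ)).aemeasurable.congr ?_
      filter_upwards [hedist s hs t ht] with ω hω
      rw [← hω, ← ENNReal.rpow_natCast, ← ENNReal.rpow_mul]
      norm_num
    have hX_four : ∀ s ∈ Set.Icc (0 : ℝ) 1, ∀ t ∈ Set.Icc (0 : ℝ) 1,
        ∫⁻ ω, edist (X s ω) (X t ω) ^ 4 ∂P'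
          ≤ (M * I.toNNReal ^ 2 : NNReal) * ENNReal.ofReal (|s - t| ^ 2) := by
      intro s hs t ht
      rw [lintegral_congr_ae (hedist s hs t ht)]
      refine (hD_four s hs t ht).trans (le_of_eq ?_)
      rw [ENNReal.ofReal_mul hI0, mul_pow, ← mul_assoc, ENNReal.ofReal_pow (abs_nonneg _)]
      push_cast
      rfl
    obtain ⟨Y, hY, hYX⟩ :=
      exists_continuous_version_of_lintegral_edist_pow_four_le X _ hX_meas hX_four
    refine ⟨Y, hY, fun t ht => ?_⟩
    filter_upwards [hYX t ht, hmem t ht] with ω h1 h2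
    rw [h1]
    simp only [hX, dif_pos h2]
    exact h2.coeFn_toLp
end

section
/- Coefficient conditions for the interpolation process: fix s ∈ S with h(s) ∈ (1/2,1) and t ∈ [0,1]. Then (i) sup_{j∈ℤ} | n^{d(s)−3/2} a_{nj}(s,t) | → 0 as n → ∞, and (ii) limsup_{n→∞} n^{2h(s)−3} ∑_{j∈ℤ} |a_{nj}(s,t)|² = (c(s)+conj(c(s))) t^{3−2h(s)} / (2(3−2h(s))(1−h(s))) ≤ max{t, t²} · ( 1/(1−h(s))² + 1/((1−h(s))(2h(s)−1)) ) < ∞. -/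
open Filter

theorem tendsto_add_one_rpow_sub_rpow_div {q : ℝ} :
    Tendsto (fun k : ℕ => (((k : ℝ) + 1) ^ q - (k : ℝ) ^ q) / (k : ℝ) ^ (q - 1)) atTop (nhds q) := by
  have hd : HasDerivAt (fun x : ℝ => x ^ q) (q * 1 ^ (q - 1)) 1 :=
    Real.hasDerivAt_rpow_const (Or.inl one_ne_zero)
  rw [hasDerivAt_iff_tendsto_slope_zero] at hd
  have h0 : Tendsto (fun k : ℕ => ((k : ℝ))⁻¹) atTop (nhdsWithin 0 {0}ᶜ) := by
    refine tendsto_nhdsWithin_iff.2 ⟨tendsto_inv_atTop_nhds_zero_nat, ?_⟩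
    filter_upwards [eventually_gt_atTop 0] with k hk
    simp; omega
  have h := hd.comp h0
  simp only [Real.one_rpow, mul_one] at h
  refine h.congr' ?_
  filter_upwards [eventually_gt_atTop 0] with k hk
  have hk' : (0 : ℝ) < k := by exact_mod_cast hk
  have e1 : (k : ℝ) + 1 = k * (1 + (k : ℝ)⁻¹) := by field_simp
  simp only [Function.comp_apply, inv_inv, smul_eq_mul]
  rw [e1, Real.mul_rpow hk'.le (by positivity), Real.rpow_sub_one hk'.ne']
  have : (k : ℝ) ^ q ≠ 0 := (Real.rpow_pos_of_pos hk' q).ne'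
  field_simp

theorem tendsto_sum_range_div_rpow {q L : ℝ} (hq : 0 < q) {u : ℕ → ℝ}
    (hu : Tendsto (fun k : ℕ => u k / (k : ℝ) ^ (q - 1)) atTop (nhds L)) :
    Tendsto (fun m : ℕ => (∑ k ∈ Finset.range m, u k) / (m : ℝ) ^ q) atTop (nhds (L / q)) := by
  set g : ℕ → ℝ := fun k => ((k : ℝ) + 1) ^ q - (k : ℝ) ^ q with hg
  have hgpos : ∀ k, 0 < g k := fun k => by
    have := Real.rpow_lt_rpow (by positivity : (0 : ℝ) ≤ k) (lt_add_one (k : ℝ)) hq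
    simp only [hg]; linarith
  have hsum : ∀ m, ∑ k ∈ Finset.range m, g k = (m : ℝ) ^ q := fun m => by
    have := Finset.sum_range_sub (fun k : ℕ => (k : ℝ) ^ q) m
    simpa [hg, Real.zero_rpow hq.ne'] using this
  have hratio : Tendsto (fun k => u k / g k) atTop (nhds (L / q)) := by
    refine (hu.div tendsto_add_one_rpow_sub_rpow_div hq.ne').congr' ?_
    filter_upwards [eventually_gt_atTop 0] with k hk
    have hk' : (0 : ℝ) < k := by exact_mod_cast hk
    exact div_div_div_cancel_right₀ (Real.rpow_pos_of_pos hk' _).ne' _ _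
  have hlo : (fun k => u k - L / q * g k) =o[atTop] g := by
    rw [Asymptotics.isLittleO_iff_tendsto (fun k hk => absurd hk (hgpos k).ne')]
    have := hratio.sub_const (L / q)
    rw [sub_self] at this
    refine this.congr fun k => ?_
    have := (hgpos k).ne'
    field_simp
  have hT : Tendsto (fun m : ℕ => (m : ℝ) ^ q) atTop atTop :=
    (tendsto_rpow_atTop hq).comp tendsto_natCast_atTop_atTop
  have h := hlo.sum_range (fun k => (hgpos k).le) (by simpa only [hsum] using hT)
  simp only [Finset.sum_sub_distrib, ← Finset.mul_sum, hsum] at h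
  have h' := (h.tendsto_div_nhds_zero).add_const (L / q)
  rw [zero_add] at h'
  refine h'.congr' ?_
  filter_upwards [eventually_gt_atTop 0] with k hk
  have hk' : (0 : ℝ) < (k : ℝ) ^ q := Real.rpow_pos_of_pos (by exact_mod_cast hk) _
  field_simp
  ring

theorem integral_Ioi_natCeil {g : ℕ → ℂ}
    (hg : MeasureTheory.IntegrableOn (fun x : ℝ => g ⌈x⌉₊) (Set.Ioi 0)) :
    ∫ x in Set.Ioi (0 : ℝ), g ⌈x⌉₊ = ∑' j : ℕ, g (j + 1) := by
  have hU : Set.Ioi (0 : ℝ) = ⋃ j : ℕ, Set.Ioc (j : ℝ) (j + 1) := by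
    ext x
    simp only [Set.mem_Ioi, Set.mem_iUnion, Set.mem_Ioc]
    constructor
    · intro hx
      have h1 := Nat.ceil_pos.2 hx
      obtain ⟨j, hj⟩ := Nat.exists_eq_succ_of_ne_zero h1.ne'
      refine ⟨j, ?_, ?_⟩
      · exact Nat.lt_ceil.1 (by omega)
      · have := Nat.le_ceil x
        rw [hj] at this
        exact_mod_cast this
    · rintro ⟨j, h, -⟩
      exact (Nat.cast_nonneg j).trans_lt h
  have hc : ∀ (j : ℕ), ∀ x ∈ Set.Ioc (j : ℝ) (j + 1), ⌈x⌉₊ = j + 1 := by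
    intro j x hx
    rw [Nat.ceil_eq_iff (by omega)]
    simpa using hx
  rw [hU] at hg ⊢
  rw [MeasureTheory.integral_iUnion (fun _ => measurableSet_Ioc) ?_ hg]
  · congr 1
    ext j
    rw [MeasureTheory.setIntegral_congr_fun measurableSet_Ioc
      (fun x hx => by rw [hc j x hx] : Set.EqOn _ (fun _ => g (j + 1)) _)]
    simp
  · intro i j hij
    refine Set.disjoint_left.2 fun x hi hj => hij ?_
    have := hc i x hi
    have := hc j x hj
    omega

/-- The covariance kernel `x^{-d} (x+1)^{-conj d}`. -/
noncomputable def covKernel (d : ℂ) (x : ℝ) : ℂ :=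
  (x : ℂ) ^ (-d) * ((x : ℂ) + 1) ^ (-(starRingEnd ℂ) d)

theorem norm_covKernel (d : ℂ) {x : ℝ} (hx : 0 < x) :
    ‖covKernel d x‖ = x ^ (-d.re) * (x + 1) ^ (-d.re) := by
  have h := Complex.norm_cpow_eq_rpow_re_of_pos (by linarith : (0 : ℝ) < x + 1)
    (-(starRingEnd ℂ) d)
  push_cast at h
  rw [covKernel, norm_mul, Complex.norm_cpow_eq_rpow_re_of_pos hx, h]
  simp

theorem norm_covKernel_anti (d : ℂ) (h0 : 0 ≤ d.re) {x y : ℝ} (hx : 0 < x) (hxy : x ≤ y) :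
    ‖covKernel d y‖ ≤ ‖covKernel d x‖ := by
  rw [norm_covKernel d hx, norm_covKernel d (hx.trans_le hxy)]
  have : 0 < y := hx.trans_le hxy
  exact mul_le_mul (Real.rpow_le_rpow_of_nonpos hx hxy (by linarith))
    (Real.rpow_le_rpow_of_nonpos (by linarith) (by linarith) (by linarith))
    (by positivity) (by positivity)

theorem continuousOn_covKernel (d : ℂ) : ContinuousOn (covKernel d) (Set.Ioi 0) := by
  intro x hx
  have hx : (0 : ℝ) < x := hx
  apply ContinuousAt.continuousWithinAt
  refine ContinuousAt.mul ?_ ?_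
  · exact Complex.continuous_ofReal.continuousAt.cpow continuousAt_const
      (Complex.ofReal_mem_slitPlane.2 hx)
  · refine (Complex.continuous_ofReal.add continuous_const).continuousAt.cpow continuousAt_const ?_
    have := Complex.ofReal_mem_slitPlane.2 (by linarith : (0 : ℝ) < x + 1)
    simpa using this

theorem norm_covKernel_le_rpow (d : ℂ) (h0 : 0 ≤ d.re) {x : ℝ} (hx : 0 < x) :
    ‖covKernel d x‖ ≤ x ^ (-d.re) := by
  rw [norm_covKernel d hx]
  exact mul_le_of_le_one_right (by positivity)
    (Real.rpow_le_one_of_one_le_of_nonpos (by linarith) (by linarith))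

theorem norm_covKernel_le_rpow_two (d : ℂ) (h0 : 0 ≤ d.re) {x : ℝ} (hx : 0 < x) :
    ‖covKernel d x‖ ≤ x ^ (-(2 * d.re)) := by
  rw [norm_covKernel d hx, (by ring : -(2 * d.re) = -d.re + -d.re), Real.rpow_add hx]
  exact mul_le_mul_of_nonneg_left (Real.rpow_le_rpow_of_nonpos hx (by linarith) (by linarith))
    (by positivity)

theorem integrableOn_Ioc_zero_one_rpow {r : ℝ} (hr : -1 < r) :
    MeasureTheory.IntegrableOn (fun x : ℝ => x ^ r) (Set.Ioc 0 1) :=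
  (intervalIntegrable_iff_integrableOn_Ioc_of_le zero_le_one).1
    (intervalIntegral.intervalIntegrable_rpow' hr)

theorem integrableOn_covKernel_Ioc (d : ℂ) (h0 : 0 ≤ d.re) (h2 : d.re < 1) :
    MeasureTheory.IntegrableOn (covKernel d) (Set.Ioc 0 1) := by
  refine MeasureTheory.Integrable.mono'
    (integrableOn_Ioc_zero_one_rpow (by linarith : -1 < -d.re)) ?_ ?_
  · exact ((continuousOn_covKernel d).mono fun x hx => hx.1).aestronglyMeasurable measurableSet_Ioc
  · exact (MeasureTheory.ae_restrict_iff' measurableSet_Ioc).2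
      (MeasureTheory.ae_of_all _ fun x hx => norm_covKernel_le_rpow d h0 hx.1)

theorem integrableOn_covKernel_Ioi_one (d : ℂ) (h1 : 1 / 2 < d.re) :
    MeasureTheory.IntegrableOn (covKernel d) (Set.Ioi 1) := by
  refine MeasureTheory.Integrable.mono'
    (integrableOn_Ioi_rpow_of_lt (by linarith : -(2 * d.re) < -1) one_pos) ?_ ?_
  · exact ((continuousOn_covKernel d).mono
      (Set.Ioi_subset_Ioi zero_le_one)).aestronglyMeasurable measurableSet_Ioi
  · exact (MeasureTheory.ae_restrict_iff' measurableSet_Ioi).2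
      (MeasureTheory.ae_of_all _ fun x hx => norm_covKernel_le_rpow_two d (by linarith) (zero_lt_one.trans hx))

theorem integrableOn_covKernel (d : ℂ) (h1 : 1 / 2 < d.re) (h2 : d.re < 1) :
    MeasureTheory.IntegrableOn (covKernel d) (Set.Ioi 0) := by
  rw [← Set.Ioc_union_Ioi_eq_Ioi (zero_le_one' ℝ)]
  exact (integrableOn_covKernel_Ioc d (by linarith) h2).union (integrableOn_covKernel_Ioi_one d h1)

theorem norm_integral_covKernel_le (d : ℂ) (h1 : 1 / 2 < d.re) (h2 : d.re < 1) :
    ‖∫ x in Set.Ioi (0 : ℝ), covKernel d x‖ ≤ 1 / (1 - d.re) + 1 / (2 * d.re - 1) := by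
  rw [← Set.Ioc_union_Ioi_eq_Ioi (zero_le_one' ℝ), MeasureTheory.setIntegral_union
    (Set.Ioc_disjoint_Ioi le_rfl) measurableSet_Ioi
    (integrableOn_covKernel_Ioc d (by linarith) h2) (integrableOn_covKernel_Ioi_one d h1)]
  refine (norm_add_le _ _).trans (add_le_add ?_ ?_)
  · have h := MeasureTheory.norm_integral_le_of_norm_le
      (integrableOn_Ioc_zero_one_rpow (by linarith : -1 < -d.re))
      ((MeasureTheory.ae_restrict_iff' measurableSet_Ioc).2
        (MeasureTheory.ae_of_all _ fun x hx => norm_covKernel_le_rpow d (by linarith) hx.1))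
    refine h.trans_eq ?_
    rw [← intervalIntegral.integral_of_le zero_le_one, integral_rpow (Or.inl (by linarith)),
      Real.one_rpow, Real.zero_rpow (by linarith)]
    ring
  · have h := MeasureTheory.norm_integral_le_of_norm_le
      (integrableOn_Ioi_rpow_of_lt (by linarith : -(2 * d.re) < -1) one_pos)
      ((MeasureTheory.ae_restrict_iff' measurableSet_Ioi).2
        (MeasureTheory.ae_of_all _ fun x hx =>
          norm_covKernel_le_rpow_two d (by linarith) (zero_lt_one.trans hx)))
    refine h.trans_eq ?_
    rw [integral_Ioi_rpow_of_lt (by linarith) one_pos, Real.one_rpow,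
      (by ring : -(2 * d.re) + 1 = -(2 * d.re - 1)), neg_div_neg_eq]

theorem norm_covKernel_ceil_le (d : ℂ) (h0 : 0 ≤ d.re) {k : ℕ} (hk : 0 < k) {x : ℝ} (hx : 0 < x) :
    ‖covKernel d (⌈x * k⌉₊ / k)‖ ≤ ‖covKernel d x‖ := by
  refine norm_covKernel_anti d h0 hx ?_
  rw [le_div_iff₀ (by exact_mod_cast hk)]
  exact Nat.le_ceil _

theorem aestronglyMeasurable_covKernel_ceil (d : ℂ) (k : ℕ) :
    MeasureTheory.AEStronglyMeasurable (fun x : ℝ => covKernel d (⌈x * k⌉₊ / k))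
      (MeasureTheory.volume.restrict (Set.Ioi 0)) := by
  have h : Measurable fun n : ℕ => covKernel d ((n : ℝ) / k) := measurable_from_top
  exact (h.comp (Nat.measurable_ceil.comp
    (measurable_id.mul_const (k : ℝ)))).aestronglyMeasurable

theorem tendsto_integral_covKernel_ceil (d : ℂ) (h1 : 1 / 2 < d.re) (h2 : d.re < 1) :
    Tendsto (fun k : ℕ => ∫ x in Set.Ioi (0 : ℝ), covKernel d (⌈x * k⌉₊ / k)) atTop
      (nhds (∫ x in Set.Ioi (0 : ℝ), covKernel d x)) := by
  refine MeasureTheory.tendsto_integral_filter_of_dominated_convergence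
    (fun x => ‖covKernel d x‖) (Eventually.of_forall (aestronglyMeasurable_covKernel_ceil d)) ?_
    (integrableOn_covKernel d h1 h2).norm ?_
  · filter_upwards [eventually_gt_atTop 0] with k hk
    exact (MeasureTheory.ae_restrict_iff' measurableSet_Ioi).2
      (MeasureTheory.ae_of_all _ fun x hx => norm_covKernel_ceil_le d (by linarith) hk hx)
  · refine (MeasureTheory.ae_restrict_iff' measurableSet_Ioi).2 (MeasureTheory.ae_of_all _ fun x hx => ?_)
    have hc := (continuousOn_covKernel d).continuousAt (Ioi_mem_nhds hx)
    exact hc.tendsto.comp ((tendsto_nat_ceil_mul_div_atTop (le_of_lt hx)).comp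
      tendsto_natCast_atTop_atTop)

theorem integral_covKernel_ceil (d : ℂ) (h1 : 1 / 2 < d.re) (h2 : d.re < 1) {k : ℕ} (hk : 0 < k) :
    ∫ x in Set.Ioi (0 : ℝ), covKernel d (⌈x * k⌉₊ / k) =
      ((k : ℝ)⁻¹ : ℝ) • ∑' j : ℕ, covKernel d ((j + 1 : ℕ) / k) := by
  have hk' : (0 : ℝ) < k := by exact_mod_cast hk
  have hint : MeasureTheory.IntegrableOn (fun x : ℝ => covKernel d (⌈x * k⌉₊ / k)) (Set.Ioi 0) :=
    MeasureTheory.Integrable.mono (integrableOn_covKernel d h1 h2)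
      (aestronglyMeasurable_covKernel_ceil d k)
      ((MeasureTheory.ae_restrict_iff' measurableSet_Ioi).2
        (MeasureTheory.ae_of_all _ fun x hx => norm_covKernel_ceil_le d (by linarith) hk hx))
  have hint' := (MeasureTheory.integrableOn_Ioi_comp_mul_right_iff
    (fun x : ℝ => covKernel d (⌈x⌉₊ / k)) 0 hk').1 hint
  rw [MeasureTheory.integral_comp_mul_right_Ioi (fun x : ℝ => covKernel d (⌈x⌉₊ / k)) 0 hk',
    zero_mul]
  rw [zero_mul] at hint'
  rw [integral_Ioi_natCeil (g := fun n : ℕ => covKernel d ((n : ℝ) / k)) hint']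

theorem covKernel_div (d : ℂ) {x k : ℝ} (hx : 0 < x) (hk : 0 < k) :
    covKernel d (x / k) = ((k ^ (2 * d.re) : ℝ) : ℂ) *
      ((x : ℂ) ^ (-d) * ((x + k : ℝ) : ℂ) ^ (-(starRingEnd ℂ) d)) := by
  have hk' : (k : ℂ) ≠ 0 := by exact_mod_cast hk.ne'
  have e1 : (x : ℂ) ^ (-d) = ((x / k : ℝ) : ℂ) ^ (-d) * (k : ℂ) ^ (-d) := by
    rw [← Complex.mul_cpow_ofReal_nonneg (by positivity) hk.le]
    congr 1
    push_cast
    field_simp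
  have e2 : ((x + k : ℝ) : ℂ) ^ (-(starRingEnd ℂ) d) =
      (((x / k : ℝ) : ℂ) + 1) ^ (-(starRingEnd ℂ) d) * (k : ℂ) ^ (-(starRingEnd ℂ) d) := by
    have := Complex.mul_cpow_ofReal_nonneg (by positivity : 0 ≤ x / k + 1) hk.le
      (-(starRingEnd ℂ) d)
    rw [← Complex.ofReal_one, ← Complex.ofReal_add, ← this]
    congr 1
    push_cast
    field_simp
  have e3 : ((k ^ (2 * d.re) : ℝ) : ℂ) * ((k : ℂ) ^ (-d) * (k : ℂ) ^ (-(starRingEnd ℂ) d)) = 1 := by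
    rw [← Complex.cpow_add _ _ hk', Complex.ofReal_cpow hk.le, ← Complex.cpow_add _ _ hk']
    rw [(_ : (((2 * d.re : ℝ) : ℂ)) + (-d + -(starRingEnd ℂ) d) = 0), Complex.cpow_zero]
    apply Complex.ext <;> simp
    ring
  rw [e1, e2, covKernel]
  linear_combination (-(((x / k : ℝ) : ℂ) ^ (-d) *
    (((x / k : ℝ) : ℂ) + 1) ^ (-(starRingEnd ℂ) d))) * e3

/-- The autocovariances of the moving average with weights `(j+1)^{-d}` are regularly varying. -/
theorem tendsto_autocov (d : ℂ) (h1 : 1 / 2 < d.re) (h2 : d.re < 1) :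
    Tendsto (fun k : ℕ => (((k : ℝ) ^ (2 * d.re - 1) : ℝ) : ℂ) *
      ∑' j : ℕ, ((j + 1 : ℕ) : ℂ) ^ (-d) * ((j + 1 + k : ℕ) : ℂ) ^ (-(starRingEnd ℂ) d)) atTop
      (nhds (∫ x in Set.Ioi (0 : ℝ), covKernel d x)) := by
  refine (tendsto_integral_covKernel_ceil d h1 h2).congr' ?_
  filter_upwards [eventually_gt_atTop 0] with k hk
  have hk' : (0 : ℝ) < k := by exact_mod_cast hk
  rw [integral_covKernel_ceil d h1 h2 hk]
  have : ∀ j : ℕ, covKernel d ((j + 1 : ℕ) / k) = (((k : ℝ) ^ (2 * d.re) : ℝ) : ℂ) *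
      (((j + 1 : ℕ) : ℂ) ^ (-d) * ((j + 1 + k : ℕ) : ℂ) ^ (-(starRingEnd ℂ) d)) := fun j => by
    rw [covKernel_div d (by positivity) hk']
    push_cast
    rfl
  simp_rw [this, tsum_mul_left]
  rw [Real.rpow_sub_one hk'.ne', Complex.real_smul]
  push_cast
  ring

/-- Partial sums of a stationary sequence with regularly varying covariances. -/
theorem tendsto_norm_sum_sq_div_rpow {E : Type*} [NormedAddCommGroup E] [InnerProductSpace ℂ E]
    {e : ℕ → E} {γ : ℕ → ℂ} (he : ∀ k i, inner ℂ (e (k + i)) (e k) = γ i) {p L : ℝ} (hp : 0 < p)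
    (hγ : Tendsto (fun k : ℕ => (γ k).re / (k : ℝ) ^ (p - 1)) atTop (nhds L)) :
    Tendsto (fun m : ℕ => ‖∑ k ∈ Finset.range m, e k‖ ^ 2 / (m : ℝ) ^ (p + 1)) atTop
      (nhds (2 * L / (p * (p + 1)))) := by
  set A : ℕ → E := fun m => ∑ k ∈ Finset.range m, e k with hA
  have hcross : ∀ k, (inner ℂ (A k) (e k)).re =
      ∑ i ∈ Finset.range k, (γ i).re + (γ k).re - (γ 0).re := by
    intro k
    have h1 : (inner ℂ (A k) (e k)).re = ∑ i ∈ Finset.range k, (γ (i + 1)).re := by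
      rw [hA, sum_inner, Complex.re_sum, ← Finset.sum_range_reflect]
      refine Finset.sum_congr rfl fun i hi => ?_
      have hi := Finset.mem_range.1 hi
      have h := he (k - 1 - i) (i + 1)
      rw [(by omega : k - 1 - i + (i + 1) = k)] at h
      rw [← h]
      exact inner_re_symm (𝕜 := ℂ) _ _
    have h2 := Finset.sum_range_succ (fun i => (γ i).re) k
    rw [Finset.sum_range_succ'] at h2
    linarith
  have hdiff : ∀ k, ‖A (k + 1)‖ ^ 2 - ‖A k‖ ^ 2 =
      2 * ∑ i ∈ Finset.range k, (γ i).re + (2 * (γ k).re - (γ 0).re) := by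
    intro k
    have h1 : A (k + 1) = A k + e k := Finset.sum_range_succ _ _
    have h2 : ‖e k‖ ^ 2 = (γ 0).re := by
      rw [← he k 0, add_zero]
      exact norm_sq_eq_re_inner (𝕜 := ℂ) (e k)
    have h3 := norm_add_sq (𝕜 := ℂ) (A k) (e k)
    rw [RCLike.re_eq_complex_re, hcross] at h3
    rw [h1, h3, h2]
    ring
  have hsum : ∀ m, ∑ k ∈ Finset.range m,
      (2 * ∑ i ∈ Finset.range k, (γ i).re + (2 * (γ k).re - (γ 0).re)) = ‖A m‖ ^ 2 := by
    intro m
    simp_rw [← hdiff]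
    rw [Finset.sum_range_sub (fun k => ‖A k‖ ^ 2)]
    simp [hA]
  have hinv : Tendsto (fun k : ℕ => ((k : ℝ))⁻¹) atTop (nhds 0) := tendsto_inv_atTop_nhds_zero_nat
  have hpinv : Tendsto (fun k : ℕ => ((k : ℝ) ^ p)⁻¹) atTop (nhds 0) :=
    tendsto_inv_atTop_zero.comp ((tendsto_rpow_atTop hp).comp tendsto_natCast_atTop_atTop)
  have hD : Tendsto (fun k : ℕ => (2 * ∑ i ∈ Finset.range k, (γ i).re +
      (2 * (γ k).re - (γ 0).re)) / (k : ℝ) ^ (p + 1 - 1)) atTop (nhds (2 * (L / p))) := by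
    have h := (((tendsto_sum_range_div_rpow hp hγ).const_mul 2).add
      ((hγ.mul hinv).const_mul 2)).sub (hpinv.const_mul (γ 0).re)
    simp only [mul_zero, add_zero, sub_zero] at h
    refine h.congr' ?_
    filter_upwards [eventually_gt_atTop 0] with k hk
    have hk' : (0 : ℝ) < k := by exact_mod_cast hk
    have : (k : ℝ) ^ p ≠ 0 := (Real.rpow_pos_of_pos hk' _).ne'
    rw [Real.rpow_sub_one hk'.ne', add_sub_cancel_right]
    field_simp
    ring
  have h := tendsto_sum_range_div_rpow (by linarith : 0 < p + 1) hD
  simp only [hsum] at h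
  convert h using 2
  have : p + 1 ≠ 0 := by linarith
  field_simp

theorem tendsto_norm_sq_div_rpow_of_norm_sub_le {E : Type*} [NormedAddCommGroup E] {x y : ℕ → E}
    {C q K : ℝ} (hq : 0 < q) (hxy : ∀ n, ‖y n - x n‖ ≤ C)
    (hx : Tendsto (fun n : ℕ => ‖x n‖ ^ 2 / (n : ℝ) ^ q) atTop (nhds K)) :
    Tendsto (fun n : ℕ => ‖y n‖ ^ 2 / (n : ℝ) ^ q) atTop (nhds K) := by
  have hK : 0 ≤ K := ge_of_tendsto' hx fun n => by positivity
  have hsq : ∀ (z : ℕ → E) (n : ℕ), (‖z n‖ / √((n : ℝ) ^ q)) ^ 2 = ‖z n‖ ^ 2 / (n : ℝ) ^ q := by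
    intro z n
    rw [div_pow, Real.sq_sqrt (by positivity)]
  have h1 : Tendsto (fun n : ℕ => ‖x n‖ / √((n : ℝ) ^ q)) atTop (nhds √K) := by
    refine hx.sqrt.congr fun n => ?_
    rw [Real.sqrt_div (by positivity), Real.sqrt_sq (norm_nonneg _)]
  have h2 : Tendsto (fun n : ℕ => C / √((n : ℝ) ^ q)) atTop (nhds 0) :=
    (Real.tendsto_sqrt_atTop.comp ((tendsto_rpow_atTop hq).comp
      tendsto_natCast_atTop_atTop)).const_div_atTop C
  have h3 : Tendsto (fun n : ℕ => ‖y n‖ / √((n : ℝ) ^ q) - ‖x n‖ / √((n : ℝ) ^ q)) atTop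
      (nhds 0) := by
    refine squeeze_zero_norm (fun n => ?_) h2
    rw [← sub_div, norm_div, Real.norm_of_nonneg (Real.sqrt_nonneg _)]
    gcongr
    exact (abs_norm_sub_norm_le _ _).trans (hxy n)
  have h4 := (h3.add h1).pow 2
  rw [zero_add, Real.sq_sqrt hK] at h4
  refine h4.congr fun n => ?_
  rw [sub_add_cancel, hsq]

/-- The moving average weights `(j+1)^{-d}`, extended by zero to negative indices. -/
noncomputable def maWeight (d : ℂ) (j : ℤ) : ℂ := if 0 ≤ j then ((j : ℂ) + 1) ^ (-d) else 0

theorem maWeight_natCast (d : ℂ) (j : ℕ) : maWeight d j = ((j + 1 : ℕ) : ℂ) ^ (-d) := by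
  simp [maWeight]

theorem maWeight_of_notMem_range (d : ℂ) {j : ℤ} (hj : j ∉ Set.range ((↑) : ℕ → ℤ)) :
    maWeight d j = 0 := by
  rw [maWeight, if_neg]
  intro h
  exact hj ⟨j.toNat, Int.toNat_of_nonneg h⟩

theorem summable_norm_sq_maWeight (d : ℂ) (h1 : 1 / 2 < d.re) :
    Summable fun j : ℤ => ‖maWeight d j‖ ^ 2 := by
  rw [← (Nat.cast_injective (R := ℤ)).summable_iff
    fun j hj => by simp [maWeight_of_notMem_range d hj]]
  have h := (summable_nat_add_iff 1).2
    (Real.summable_nat_rpow.2 (by linarith : -(2 * d.re) < -1))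
  refine h.congr fun j => ?_
  have hj : (0 : ℝ) < (j + 1 : ℕ) := by positivity
  have hn := Complex.norm_cpow_eq_rpow_re_of_pos hj (-d)
  rw [Complex.ofReal_natCast] at hn
  rw [Function.comp_apply, maWeight_natCast, hn, ← Real.rpow_natCast, ← Real.rpow_mul hj.le]
  congr 1
  simp
  ring

theorem summable_norm_sq_maWeight_sub (d : ℂ) (h1 : 1 / 2 < d.re) (k : ℤ) :
    Summable fun j : ℤ => ‖maWeight d (k - j)‖ ^ 2 :=
  (Equiv.subLeft k).summable_iff.2 (summable_norm_sq_maWeight d h1)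

/-- The sequence `j ↦ v_{k-j}` as an element of `ℓ²(ℤ)`. -/
noncomputable def shiftedWeight (d : ℂ) (h1 : 1 / 2 < d.re) (k : ℤ) : lp (fun _ : ℤ => ℂ) 2 :=
  ⟨fun j => maWeight d (k - j), (memℓp_gen_iff (by simp)).2 (by
    simpa using summable_norm_sq_maWeight_sub d h1 k)⟩

theorem shiftedWeight_apply (d : ℂ) (h1 : 1 / 2 < d.re) (k j : ℤ) :
    shiftedWeight d h1 k j = maWeight d (k - j) := rfl

theorem lp_two_norm_sq (f : lp (fun _ : ℤ => ℂ) 2) : ‖f‖ ^ 2 = ∑' j, ‖f j‖ ^ 2 := by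
  simpa using lp.norm_rpow_eq_tsum (p := 2) (by simp) f

theorem norm_shiftedWeight (d : ℂ) (h1 : 1 / 2 < d.re) (k : ℤ) :
    ‖shiftedWeight d h1 k‖ = ‖shiftedWeight d h1 0‖ := by
  rw [← sq_eq_sq₀ (norm_nonneg _) (norm_nonneg _), lp_two_norm_sq, lp_two_norm_sq]
  simp only [shiftedWeight_apply]
  exact ((Equiv.subLeft k).tsum_eq fun j => ‖maWeight d j‖ ^ 2).trans
    ((Equiv.subLeft 0).tsum_eq fun j => ‖maWeight d j‖ ^ 2).symm

theorem inner_shiftedWeight (d : ℂ) (h1 : 1 / 2 < d.re) (k : ℤ) (i : ℕ) :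
    inner ℂ (shiftedWeight d h1 (k + i)) (shiftedWeight d h1 k) =
      ∑' j : ℕ, ((j + 1 : ℕ) : ℂ) ^ (-d) * ((j + 1 + i : ℕ) : ℂ) ^ (-(starRingEnd ℂ) d) := by
  rw [lp.inner_eq_tsum, ← (Equiv.subLeft k).tsum_eq]
  rw [← (Nat.cast_injective (R := ℤ)).tsum_eq]
  · refine tsum_congr fun j => ?_
    rw [shiftedWeight_apply, shiftedWeight_apply, Equiv.subLeft_apply,
      (by push_cast; ring : k + (i : ℤ) - (k - j) = ((j + i : ℕ) : ℤ)), sub_sub_cancel,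
      maWeight_natCast, maWeight_natCast, RCLike.inner_apply]
    congr 1
    rw [← map_neg, Complex.cpow_conj _ _ (by rw [Complex.natCast_arg]; exact Real.pi_pos.ne),
      map_natCast]
    congr 3
    ring
  · intro j hj
    by_contra hj'
    apply hj
    simp [shiftedWeight_apply, maWeight_of_notMem_range d hj']

theorem sum_Icc_one_natCast {M : Type*} [AddCommMonoid M] (f : ℤ → M) (m : ℕ) :
    ∑ k ∈ Finset.Icc (1 : ℤ) m, f k = ∑ k ∈ Finset.range m, f (k + 1) := by
  symm
  refine Finset.sum_nbij' (fun k : ℕ => (k : ℤ) + 1) (fun k => (k - 1).toNat) ?_ ?_ ?_ ?_ ?_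
  · intro k hk
    simp only [Finset.mem_range, Finset.mem_Icc] at *
    omega
  · intro k hk
    simp only [Finset.mem_range, Finset.mem_Icc] at *
    omega
  · intro k _
    simp
  · intro k hk
    simp only [Finset.mem_Icc] at hk
    omega
  · intro k _
    rfl

/-- The interpolated coefficients `j ↦ ∑_{k=1}^m v_{k-j} + r v_{m+1-j}` in `ℓ²(ℤ)`. -/
noncomputable def interpVec (d : ℂ) (h1 : 1 / 2 < d.re) (m : ℕ) (r : ℝ) :
    lp (fun _ : ℤ => ℂ) 2 :=
  ∑ k ∈ Finset.range m, shiftedWeight d h1 (k + 1) + (r : ℂ) • shiftedWeight d h1 (m + 1)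

theorem interpVec_apply (d : ℂ) (h1 : 1 / 2 < d.re) (m : ℕ) (r : ℝ) (j : ℤ) :
    interpVec d h1 m r j = ∑ k ∈ Finset.Icc (1 : ℤ) m, maWeight d (k - j) +
      (r : ℂ) * maWeight d (m + 1 - j) := by
  rw [sum_Icc_one_natCast, interpVec, lp.coeFn_add, Pi.add_apply, lp.coeFn_sum, Finset.sum_apply]
  rfl

theorem norm_interpVec_apply_le (d : ℂ) (h1 : 1 / 2 < d.re) (m : ℕ) {r : ℝ} (hr0 : 0 ≤ r)
    (hr1 : r ≤ 1) (j : ℤ) :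
    ‖interpVec d h1 m r j‖ ≤ √((m + 1) * ∑' i : ℤ, ‖maWeight d i‖ ^ 2) := by
  have hb : ‖interpVec d h1 m r j‖ ≤
      ∑ k ∈ Finset.range (m + 1), ‖maWeight d ((k : ℤ) + 1 - j)‖ := by
    rw [interpVec_apply, sum_Icc_one_natCast, Finset.sum_range_succ]
    refine (norm_add_le _ _).trans (add_le_add (norm_sum_le _ _) ?_)
    rw [norm_mul, Complex.norm_real, Real.norm_of_nonneg hr0]
    exact mul_le_of_le_one_left (norm_nonneg _) hr1
  refine hb.trans (Real.le_sqrt_of_sq_le (sq_sum_le_card_mul_sum_sq.trans ?_))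
  rw [Finset.card_range]
  push_cast
  have hs := summable_norm_sq_maWeight d h1
  have hi : Function.Injective fun k : ℕ => (k : ℤ) + 1 - j := fun a b h => by
    simp only at h
    omega
  gcongr
  exact ((hs.comp_injective hi).sum_le_tsum _
    fun _ _ => by simp only [Function.comp_apply]; positivity).trans
    (tsum_comp_le_tsum_of_inj hs (fun _ => by positivity) hi)

theorem tendsto_iSup_norm_interpVec (d : ℂ) (h1 : 1 / 2 < d.re) (h2 : d.re < 1) {m : ℕ → ℕ}
    (hm : ∀ n, m n ≤ n) {r : ℕ → ℝ} (hr0 : ∀ n, 0 ≤ r n) (hr1 : ∀ n, r n ≤ 1) :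
    Tendsto (fun n : ℕ => ⨆ j : ℤ,
      ENNReal.ofReal ‖(n : ℂ) ^ (d - 3 / 2) * interpVec d h1 (m n) (r n) j‖) atTop (nhds 0) := by
  set C := ∑' i : ℤ, ‖maWeight d i‖ ^ 2 with hC
  have hC0 : 0 ≤ C := tsum_nonneg fun _ => by positivity
  have hlim : Tendsto (fun n : ℕ => ENNReal.ofReal (√(2 * C) * (n : ℝ) ^ (-(1 - d.re)))) atTop
      (nhds 0) := by
    rw [← ENNReal.ofReal_zero]
    refine ENNReal.tendsto_ofReal ?_
    have := ((tendsto_rpow_neg_atTop (by linarith : 0 < 1 - d.re)).comp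
      tendsto_natCast_atTop_atTop).const_mul √(2 * C)
    rwa [mul_zero] at this
  refine tendsto_of_tendsto_of_tendsto_of_le_of_le' tendsto_const_nhds hlim
    (Eventually.of_forall fun _ => zero_le) ?_
  filter_upwards [eventually_ge_atTop 1] with n hn
  have hn1 : (1 : ℝ) ≤ n := by exact_mod_cast hn
  have hn' : (0 : ℝ) < n := by linarith
  refine iSup_le fun j => ENNReal.ofReal_le_ofReal ?_
  have hmn : (m n : ℝ) ≤ n := by exact_mod_cast hm n
  have hpow := Complex.norm_cpow_eq_rpow_re_of_pos hn' (d - 3 / 2)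
  have hre : (d - 3 / 2).re = -(1 - d.re) - 1 / 2 := by
    rw [Complex.sub_re, (by norm_num : (3 / 2 : ℂ) = ((3 / 2 : ℝ) : ℂ)), Complex.ofReal_re]
    ring
  rw [Complex.ofReal_natCast, hre, Real.rpow_sub hn', ← Real.sqrt_eq_rpow] at hpow
  rw [norm_mul, hpow]
  have hle : ‖interpVec d h1 (m n) (r n) j‖ ≤ √(2 * C) * √n := by
    refine (norm_interpVec_apply_le d h1 (m n) (hr0 n) (hr1 n) j).trans ?_
    rw [← Real.sqrt_mul (by positivity)]
    refine Real.sqrt_le_sqrt ?_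
    rw [← hC]
    nlinarith
  have hsn : 0 < √(n : ℝ) := Real.sqrt_pos.2 hn'
  calc _ ≤ (n : ℝ) ^ (-(1 - d.re)) / √n * (√(2 * C) * √n) := by gcongr
    _ = _ := by field_simp

theorem tendsto_norm_interpVec_sq (d : ℂ) (h1 : 1 / 2 < d.re) (h2 : d.re < 1) {t : ℝ}
    (ht : 0 ≤ t) :
    Tendsto (fun n : ℕ => ‖interpVec d h1 ⌊t * n⌋₊ (Int.fract (t * n))‖ ^ 2 /
        (n : ℝ) ^ (3 - 2 * d.re)) atTop
      (nhds ((∫ x in Set.Ioi (0 : ℝ), covKernel d x).re * t ^ (3 - 2 * d.re) /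
        ((3 - 2 * d.re) * (1 - d.re)))) := by
  have hq : 0 < 3 - 2 * d.re := by linarith
  set c := ∫ x in Set.Ioi (0 : ℝ), covKernel d x with hc
  set A : ℕ → lp (fun _ : ℤ => ℂ) 2 :=
    fun m => ∑ k ∈ Finset.range m, shiftedWeight d h1 (k + 1) with hA
  have hAlim : Tendsto (fun m : ℕ => ‖A m‖ ^ 2 / (m : ℝ) ^ (3 - 2 * d.re)) atTop
      (nhds (2 * c.re / ((2 - 2 * d.re) * (3 - 2 * d.re)))) := by
    have h := tendsto_norm_sum_sq_div_rpow (e := fun k : ℕ => shiftedWeight d h1 (k + 1))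
      (γ := fun i => ∑' j : ℕ, ((j + 1 : ℕ) : ℂ) ^ (-d) *
        ((j + 1 + i : ℕ) : ℂ) ^ (-(starRingEnd ℂ) d))
      (p := 2 - 2 * d.re) (L := c.re) (fun k i => ?_) (by linarith) ?_
    · rwa [(by ring : 2 - 2 * d.re + 1 = 3 - 2 * d.re)] at h
    · rw [← inner_shiftedWeight d h1 (k + 1) i]
      push_cast
      rw [add_right_comm]
    · refine ((Complex.continuous_re.tendsto _).comp (tendsto_autocov d h1 h2)).congr fun k => ?_
      rw [Function.comp_apply, Complex.re_ofReal_mul,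
        (by ring : 2 - 2 * d.re - 1 = -(2 * d.re - 1)), Real.rpow_neg (by positivity), div_inv_eq_mul,
        mul_comm]
  refine tendsto_norm_sq_div_rpow_of_norm_sub_le (x := fun n : ℕ => A ⌊t * n⌋₊)
    (C := ‖shiftedWeight d h1 0‖) hq (fun n => ?_) ?_
  · rw [interpVec, add_sub_cancel_left, norm_smul, norm_shiftedWeight, Complex.norm_real,
      Real.norm_of_nonneg (Int.fract_nonneg _)]
    exact mul_le_of_le_one_left (norm_nonneg _) (Int.fract_lt_one _).le
  · rcases ht.eq_or_lt with rfl | ht0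
    · simp [hA, Real.zero_rpow hq.ne']
    · have hfl : Tendsto (fun n : ℕ => ⌊t * n⌋₊) atTop atTop :=
        tendsto_nat_floor_atTop.comp (tendsto_natCast_atTop_atTop.const_mul_atTop ht0)
      have hrat : Tendsto (fun n : ℕ => ((⌊t * n⌋₊ : ℝ) / n) ^ (3 - 2 * d.re)) atTop
          (nhds (t ^ (3 - 2 * d.re))) :=
        ((tendsto_nat_floor_mul_div_atTop ht).comp tendsto_natCast_atTop_atTop).rpow_const
          (Or.inr hq.le)
      have h := (hAlim.comp hfl).mul hrat
      have hval : 2 * c.re / ((2 - 2 * d.re) * (3 - 2 * d.re)) * t ^ (3 - 2 * d.re) =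
          c.re * t ^ (3 - 2 * d.re) / ((3 - 2 * d.re) * (1 - d.re)) := by
        have : 1 - d.re ≠ 0 := by linarith
        have : 3 - 2 * d.re ≠ 0 := hq.ne'
        rw [(by ring : 2 - 2 * d.re = 2 * (1 - d.re))]
        field_simp
      rw [hval] at h
      refine h.congr' ?_
      filter_upwards [hfl.eventually_gt_atTop 0] with n hn
      have hn' : (0 : ℝ) < (⌊t * n⌋₊ : ℝ) := by exact_mod_cast hn
      have := (Real.rpow_pos_of_pos hn' (3 - 2 * d.re)).ne'
      rw [Function.comp_apply, Real.div_rpow hn'.le (by positivity), div_mul_div_comm,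
        mul_comm, mul_div_mul_left _ _ this]

/-- **Coefficient conditions for the interpolation process.**
Fix `s` with `h(s) = Re d(s) ∈ (1/2,1)` and `t ∈ [0,1]`, and let
`a_{nj}(s,t) = ∑_{k=1}^{⌊nt⌋} v_{k−j}(s) + {nt} v_{⌊nt⌋+1−j}(s)`.  Then
(i) `sup_{j∈ℤ} |n^{d(s)−3/2} a_{nj}(s,t)| → 0` as `n → ∞`, and
(ii) `limsup_n n^{2h(s)−3} ∑_j |a_{nj}(s,t)|²
  = (c(s)+conj(c(s))) t^{3−2h(s)} / (2(3−2h(s))(1−h(s)))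
  ≤ max{t,t²} (1/(1−h(s))² + 1/((1−h(s))(2h(s)−1)))`. -/
theorem coefficient_conditions_interpolation {S : Type*} (d : S → ℂ) (s : S)
    (h1 : 1 / 2 < (d s).re) (h2 : (d s).re < 1)
    (t : ℝ) (ht : t ∈ Set.Icc (0 : ℝ) 1)
    (v : ℤ → ℂ) (hv : ∀ j : ℤ, v j = if 0 ≤ j then ((j : ℂ) + 1) ^ (-(d s)) else 0)
    (c : ℂ)
    (hc : c = ∫ x in Set.Ioi (0 : ℝ),
      (x : ℂ) ^ (-(d s)) * ((x : ℂ) + 1) ^ (-(starRingEnd ℂ) (d s)))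
    (a : ℕ → ℤ → ℂ)
    (ha : ∀ (n : ℕ) (j : ℤ), a n j =
      (∑ k ∈ Finset.Icc (1 : ℤ) ⌊(n : ℝ) * t⌋, v (k - j)) +
        ((Int.fract ((n : ℝ) * t) : ℝ) : ℂ) * v (⌊(n : ℝ) * t⌋ + 1 - j)) :
    Tendsto (fun n : ℕ =>
        ⨆ j : ℤ, ENNReal.ofReal ‖(n : ℂ) ^ (d s - 3 / 2) * a n j‖) atTop (nhds 0)
      ∧ ((Filter.limsup
            (fun n : ℕ => (n : ℝ) ^ (2 * (d s).re - 3) * ∑' j : ℤ, ‖a n j‖ ^ 2) atTop : ℝ)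
              : ℂ)
          = (c + (starRingEnd ℂ) c) * ((t ^ (3 - 2 * (d s).re) : ℝ) : ℂ) /
              ((2 * (3 - 2 * (d s).re) * (1 - (d s).re) : ℝ) : ℂ)
      ∧ Filter.limsup
            (fun n : ℕ => (n : ℝ) ^ (2 * (d s).re - 3) * ∑' j : ℤ, ‖a n j‖ ^ 2) atTop
          ≤ max t (t ^ 2) *
              (1 / (1 - (d s).re) ^ 2 + 1 / ((1 - (d s).re) * (2 * (d s).re - 1))) := by
  have hvw : ∀ j, v j = maWeight (d s) j := hv
  have hvec : ∀ n j, a n j = interpVec (d s) h1 ⌊t * n⌋₊ (Int.fract (t * n)) j := fun n j => by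
    rw [ha, interpVec_apply, Int.natCast_floor_eq_floor (mul_nonneg ht.1 n.cast_nonneg),
      mul_comm (n : ℝ) t]
    simp only [hvw]
  have hc' : c = ∫ x in Set.Ioi (0 : ℝ), covKernel (d s) x := hc
  have hlim := tendsto_norm_interpVec_sq (d s) h1 h2 ht.1
  rw [← hc'] at hlim
  have hls : Filter.limsup
      (fun n : ℕ => (n : ℝ) ^ (2 * (d s).re - 3) * ∑' j : ℤ, ‖a n j‖ ^ 2) atTop =
      c.re * t ^ (3 - 2 * (d s).re) / ((3 - 2 * (d s).re) * (1 - (d s).re)) := by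
    refine (hlim.congr fun n => ?_).limsup_eq
    simp_rw [hvec]
    rw [lp_two_norm_sq, (by ring : 2 * (d s).re - 3 = -(3 - 2 * (d s).re)),
      Real.rpow_neg n.cast_nonneg, div_eq_inv_mul]
  have hh : 0 < 1 - (d s).re := by linarith
  have hq : 1 ≤ 3 - 2 * (d s).re := by linarith
  refine ⟨?_, ?_, ?_⟩
  · simp_rw [hvec]
    refine tendsto_iSup_norm_interpVec (d s) h1 h2 (fun n => ?_) (fun n => Int.fract_nonneg _)
      fun n => (Int.fract_lt_one _).le
    exact Nat.floor_le_of_le (mul_le_of_le_one_left n.cast_nonneg ht.2)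
  · rw [hls, Complex.add_conj, ← Complex.ofReal_mul, ← Complex.ofReal_div]
    congr 1
    rw [mul_assoc, mul_assoc 2, mul_div_mul_left _ _ two_ne_zero]
  · rw [hls, max_eq_left (by nlinarith [ht.1, ht.2] : t ^ 2 ≤ t)]
    have hcre : c.re ≤ 1 / (1 - (d s).re) + 1 / (2 * (d s).re - 1) :=
      (Complex.re_le_norm c).trans (hc' ▸ norm_integral_covKernel_le (d s) h1 h2)
    have htq : t ^ (3 - 2 * (d s).re) ≤ t := by
      simpa using Real.rpow_le_rpow_of_exponent_ge' ht.1 ht.2 zero_le_one hq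
    have hB : 0 ≤ 1 / (1 - (d s).re) + 1 / (2 * (d s).re - 1) :=
      add_nonneg (one_div_nonneg.2 hh.le) (one_div_nonneg.2 (by linarith))
    calc c.re * t ^ (3 - 2 * (d s).re) / ((3 - 2 * (d s).re) * (1 - (d s).re))
        ≤ (1 / (1 - (d s).re) + 1 / (2 * (d s).re - 1)) * t / (1 * (1 - (d s).re)) := by
          have := Real.rpow_nonneg ht.1 (3 - 2 * (d s).re)
          have := ht.1
          gcongr
      _ = _ := by
          have : 2 * (d s).re - 1 ≠ 0 := by linarith
          field_simp
end
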